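/- arXiv:1712.08956 — 2 statements merged into one kernel-verified Lean document; each statement's English description precedes it below -/
import Mathlib

section
/- Let γ ∈ (0,1) and T > 0. For λ > 0 set r_λ(t) = −(d/dt) E_γ(−λ Γ(γ) t^γ) for t > 0, where E_γ(z) = ∑_{n=0}^∞ zⁿ/Γ(nγ+1). Suppose h ∈ L¹(0,T) satisfies h > 0 a.e. and, for every λ > 0, h(t) − ∫₀ᵗ r_λ(t−s) h(s) ds > 0 for a.e. t ∈ (0,T). Let v ∈ L^∞(0,T). Then the integral equation y(t) + ∫₀ᵗ (t−s)^(γ−1) v(s) y(s) ds = h(t) has a unique solution y ∈ L¹(0,T) (the equation holding for a.e. t ∈ (0,T)), and this solution satisfies y > 0 a.e. on (0,T). -/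
open MeasureTheory Set Filter

/-- The Mittag-Leffler function `E_γ(z) = ∑_{n=0}^∞ zⁿ/Γ(nγ+1)`. -/
noncomputable def mittagLeffler (γ : ℝ) (z : ℝ) : ℝ :=
  ∑' n : ℕ, z ^ n / Real.Gamma ((n : ℝ) * γ + 1)

/-- The resolvent kernel `r_λ(t) = −(d/dt) E_γ(−λ Γ(γ) t^γ)` of the kernel `λ t^(γ−1)`. -/
noncomputable def resolventKernel (γ lam : ℝ) (t : ℝ) : ℝ :=
  -deriv (fun s : ℝ => mittagLeffler γ (-(lam * Real.Gamma γ) * s ^ γ)) t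

theorem rpow_mul_exp_neg_le_Gamma_add_one {s M : ℝ} (hs : 0 ≤ s) (hM : 0 ≤ M) :
    M ^ s * Real.exp (-M) ≤ Real.Gamma (s + 1) := by
  have hconv := Real.GammaIntegral_convergent (s := s + 1) (by linarith)
  rw [Real.Gamma_eq_integral (by linarith), ← integral_exp_neg_Ioi, ← integral_const_mul]
  calc ∫ x in Ioi M, M ^ s * Real.exp (-x)
      ≤ ∫ x in Ioi M, Real.exp (-x) * x ^ (s + 1 - 1) := by
        refine setIntegral_mono_on ((integrableOn_exp_neg_Ioi M).const_mul _)
          (hconv.mono_set (Ioi_subset_Ioi hM)) measurableSet_Ioi fun x hx => ?_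
        rw [mul_comm, add_sub_cancel_right]
        have : M ≤ x := le_of_lt hx
        gcongr
    _ ≤ ∫ x in Ioi (0 : ℝ), Real.exp (-x) * x ^ (s + 1 - 1) := by
        refine setIntegral_mono_set hconv ?_ (Ioi_subset_Ioi hM).eventuallyLE
        refine ae_restrict_of_forall_mem measurableSet_Ioi fun x hx => ?_
        have : (0 : ℝ) < x := hx
        positivity

theorem summable_pow_div_Gamma {γ x : ℝ} (hγ : 0 < γ) (hx : 0 ≤ x) :
    Summable fun n : ℕ => x ^ n / Real.Gamma (((n : ℝ) + 1) * γ) := by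
  set B := 2 * x + 1 with hB
  have hB0 : 0 < B := by positivity
  set M := B ^ (1 / γ) with hM
  have hM0 : 0 < M := by positivity
  have hMγ : M ^ γ = B := by
    rw [hM, ← Real.rpow_mul hB0.le, one_div_mul_cancel hγ.ne', Real.rpow_one]
  have hq : ‖x / B‖ < 1 := by
    rw [Real.norm_of_nonneg (by positivity), div_lt_one hB0]
    linarith
  have hsum : Summable fun n : ℕ =>
      (γ * Real.exp M / B) * ((n : ℝ) ^ 1 * (x / B) ^ n + (n : ℝ) ^ 0 * (x / B) ^ n) :=
    ((summable_pow_mul_geometric_of_norm_lt_one 1 hq).add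
      (summable_pow_mul_geometric_of_norm_lt_one 0 hq)).mul_left _
  refine Summable.of_nonneg_of_le (fun n => ?_) (fun n => ?_) hsum
  · have := Real.Gamma_pos_of_pos (s := ((n : ℝ) + 1) * γ) (by positivity)
    positivity
  · set s := ((n : ℝ) + 1) * γ with hs
    have hs0 : 0 < s := by positivity
    have hG := Real.Gamma_pos_of_pos hs0
    have hle := rpow_mul_exp_neg_le_Gamma_add_one hs0.le hM0.le
    have hMs : M ^ s = B ^ (n + 1) := by
      rw [hs, mul_comm, Real.rpow_mul hM0.le, hMγ]
      exact_mod_cast Real.rpow_natCast B (n + 1)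
    rw [Real.Gamma_add_one hs0.ne', hMs, Real.exp_neg] at hle
    rw [div_le_iff₀ hG]
    have hle' : B ^ (n + 1) ≤ s * Real.Gamma s * Real.exp M := by
      rwa [← div_eq_mul_inv, div_le_iff₀ (Real.exp_pos _)] at hle
    have : γ * Real.exp M / B * ((n : ℝ) ^ 1 * (x / B) ^ n + (n : ℝ) ^ 0 * (x / B) ^ n) *
        Real.Gamma s = (s * Real.Gamma s * Real.exp M) / B ^ (n + 1) * x ^ n := by
      rw [hs, div_pow]
      field_simp
      ring
    rw [this]
    exact le_mul_of_one_le_left (by positivity) ((one_le_div (by positivity)).2 hle')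

/-- The two-parameter Mittag-Leffler function `E_{γ,γ}(z) = ∑ zⁿ/Γ((n+1)γ)`. -/
noncomputable def mittagLefflerTwo (γ z : ℝ) : ℝ :=
  ∑' n : ℕ, z ^ n / Real.Gamma (((n : ℝ) + 1) * γ)

theorem norm_pow_div_Gamma_le {γ z R : ℝ} (hγ : 0 < γ) (hz : |z| ≤ R) (n : ℕ) :
    ‖z ^ n / Real.Gamma (((n : ℝ) + 1) * γ)‖ ≤ R ^ n / Real.Gamma (((n : ℝ) + 1) * γ) := by
  have := Real.Gamma_pos_of_pos (s := ((n : ℝ) + 1) * γ) (by positivity)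
  rw [norm_div, norm_pow, Real.norm_of_nonneg this.le, Real.norm_eq_abs]
  gcongr

theorem continuous_mittagLefflerTwo {γ : ℝ} (hγ : 0 < γ) : Continuous (mittagLefflerTwo γ) := by
  rw [continuous_iff_continuousAt]
  intro z
  have hcont : ContinuousOn (mittagLefflerTwo γ) (Metric.ball 0 (|z| + 1)) := by
    refine continuousOn_tsum (fun n => by fun_prop)
      (summable_pow_div_Gamma (x := |z| + 1) hγ (by positivity)) fun n w hw => ?_
    exact norm_pow_div_Gamma_le hγ (by simpa using (mem_ball_zero_iff.1 hw).le) n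
  exact hcont.continuousAt (Metric.isOpen_ball.mem_nhds (by simp))

theorem hasDerivAt_mittagLeffler {γ : ℝ} (hγ : 0 < γ) (z : ℝ) :
    HasDerivAt (mittagLeffler γ) (mittagLefflerTwo γ z / γ) z := by
  set R := |z| + 1 with hR
  have hR0 : 0 < R := by positivity
  have hcoef (n : ℕ) (w : ℝ) : ((n + 1 : ℕ) : ℝ) * w ^ n / Real.Gamma (((n + 1 : ℕ) : ℝ) * γ + 1) =
      w ^ n / Real.Gamma (((n : ℝ) + 1) * γ) / γ := by
    have hs : (0 : ℝ) < ((n : ℝ) + 1) * γ := by positivity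
    have := (Real.Gamma_pos_of_pos hs).ne'
    push_cast
    rw [Real.Gamma_add_one hs.ne']
    field_simp
  have hsummable (w : ℝ) (hw : |w| ≤ R) : Summable fun n : ℕ =>
      (n : ℝ) * w ^ (n - 1) / Real.Gamma ((n : ℝ) * γ + 1) := by
    rw [← summable_nat_add_iff 1]
    simp only [Nat.add_sub_cancel, hcoef]
    exact (Summable.of_norm_bounded (summable_pow_div_Gamma hγ hR0.le)
      fun n => norm_pow_div_Gamma_le hγ hw n).div_const _
  have key := hasDerivAt_tsum_of_isPreconnected (𝕜 := ℝ)
    (g := fun (n : ℕ) (z : ℝ) => z ^ n / Real.Gamma ((n : ℝ) * γ + 1))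
    (g' := fun (n : ℕ) (z : ℝ) => (n : ℝ) * z ^ (n - 1) / Real.Gamma ((n : ℝ) * γ + 1))
    (u := fun n : ℕ => (n : ℝ) * R ^ (n - 1) / Real.Gamma ((n : ℝ) * γ + 1))
    (t := Metric.ball 0 R) (y₀ := 0) (y := z)
    (hsummable R (abs_of_pos hR0).le) Metric.isOpen_ball (convex_ball 0 R).isPreconnected
    (fun n y _ => (hasDerivAt_pow n y).div_const _) (fun n y hy => ?_) (by simpa using hR0) ?_
    (by simp [hR])
  · convert! key using 1
    rw [(hsummable z (by simp [hR])).tsum_eq_zero_add]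
    simp only [Nat.add_sub_cancel, hcoef, tsum_div_const]
    simp [mittagLefflerTwo]
  · have hG := Real.Gamma_pos_of_pos (s := (n : ℝ) * γ + 1) (by positivity)
    have hy' : |y| ≤ R := by simpa using (mem_ball_zero_iff.1 hy).le
    rw [norm_div, norm_mul, norm_pow, Real.norm_of_nonneg hG.le, Real.norm_eq_abs,
      Real.norm_eq_abs, Nat.abs_cast]
    gcongr
  · exact summable_of_ne_finset_zero (s := {0}) fun n hn => by
      simp [Finset.mem_singleton.not.1 hn]

theorem resolventKernel_eq {γ lam t : ℝ} (hγ : 0 < γ) (ht : 0 < t) :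
    resolventKernel γ lam t = lam * Real.Gamma γ * t ^ (γ - 1) *
      mittagLefflerTwo γ (-(lam * Real.Gamma γ) * t ^ γ) := by
  have h1 : HasDerivAt (fun s : ℝ => -(lam * Real.Gamma γ) * s ^ γ)
      (-(lam * Real.Gamma γ) * (γ * t ^ (γ - 1))) t :=
    (Real.hasDerivAt_rpow_const (Or.inl ht.ne')).const_mul _
  have h2 := (hasDerivAt_mittagLeffler hγ (-(lam * Real.Gamma γ) * t ^ γ)).comp t h1
  have h3 := h2.deriv
  simp only [Function.comp_def] at h3
  rw [resolventKernel, h3]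
  field_simp

theorem continuousOn_rpow_Ioi (p : ℝ) : ContinuousOn (fun t : ℝ => t ^ p) (Ioi 0) := fun t ht =>
  (Real.continuousAt_rpow_const t p (Or.inl (ne_of_gt ht))).continuousWithinAt

theorem continuousOn_resolventKernel {γ : ℝ} (hγ : 0 < γ) (lam : ℝ) :
    ContinuousOn (resolventKernel γ lam) (Ioi 0) := by
  have : ContinuousOn (fun t : ℝ => lam * Real.Gamma γ * t ^ (γ - 1) *
      mittagLefflerTwo γ (-(lam * Real.Gamma γ) * t ^ γ)) (Ioi 0) :=
    (continuousOn_const.mul (continuousOn_rpow_Ioi _)).mul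
      ((continuous_mittagLefflerTwo hγ).comp_continuousOn
        (continuousOn_const.mul (continuousOn_rpow_Ioi _)))
  exact this.congr fun t ht => resolventKernel_eq hγ ht

theorem eventually_resolventKernel_pos {γ lam : ℝ} (hγ : 0 < γ) (hlam : 0 < lam) :
    ∀ᶠ t in nhdsWithin (0 : ℝ) (Ioi 0), 0 < resolventKernel γ lam t := by
  have hG := Real.Gamma_pos_of_pos hγ
  have h0 : mittagLefflerTwo γ 0 = 1 / Real.Gamma γ := by
    rw [mittagLefflerTwo, tsum_eq_single 0 (fun n hn => by simp [hn])]
    simp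
  have hcont : Continuous fun t : ℝ => mittagLefflerTwo γ (-(lam * Real.Gamma γ) * t ^ γ) :=
    (continuous_mittagLefflerTwo hγ).comp
      (continuous_const.mul (Real.continuous_rpow_const hγ.le))
  have hev : ∀ᶠ t in nhds (0 : ℝ), 0 < mittagLefflerTwo γ (-(lam * Real.Gamma γ) * t ^ γ) := by
    refine hcont.continuousAt.eventually_const_lt ?_
    simp only [Real.zero_rpow hγ.ne', mul_zero, h0]
    positivity
  filter_upwards [nhdsWithin_le_nhds hev, self_mem_nhdsWithin] with t ht ht0
  have ht0' : 0 < t := ht0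
  rw [resolventKernel_eq hγ ht0']
  positivity

theorem integral_sub_rpow_mul_rpow {a b t : ℝ} (ha : 0 < a) (hb : 0 < b) (ht : 0 < t) :
    ∫ s in Ioc 0 t, (t - s) ^ (a - 1) * s ^ (b - 1) =
      t ^ (a + b - 1) * (Real.Gamma a * Real.Gamma b / Real.Gamma (a + b)) := by
  have h := Complex.betaIntegral_scaled (b : ℂ) (a : ℂ) ht
  have h1 : ∫ x in (0 : ℝ)..t, (x : ℂ) ^ ((b : ℂ) - 1) * ((t : ℂ) - x) ^ ((a : ℂ) - 1) =
      ((∫ s in Ioc 0 t, (t - s) ^ (a - 1) * s ^ (b - 1) : ℝ) : ℂ) := by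
    rw [intervalIntegral.integral_of_le ht.le, ← integral_complex_ofReal]
    refine setIntegral_congr_fun measurableSet_Ioc fun x hx => ?_
    rw [mul_comm, Complex.ofReal_mul, Complex.ofReal_cpow hx.1.le,
      Complex.ofReal_cpow (by linarith [hx.2])]
    push_cast
    rfl
  rw [h1, Complex.betaIntegral_eq_Gamma_mul_div _ _ (by simpa) (by simpa), ← Complex.ofReal_add,
    Complex.Gamma_ofReal, Complex.Gamma_ofReal, Complex.Gamma_ofReal, ← Complex.ofReal_one,
    ← Complex.ofReal_sub, ← Complex.ofReal_cpow ht.le] at h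
  rw [add_comm a b, mul_comm (Real.Gamma a)]
  exact_mod_cast h

theorem integrableOn_sub_rpow_mul_rpow {a b t : ℝ} (ha : 0 < a) (hb : 0 < b) (ht : 0 < t) :
    IntegrableOn (fun s => (t - s) ^ (a - 1) * s ^ (b - 1)) (Ioc 0 t) := by
  refine Integrable.of_integral_ne_zero ?_
  rw [integral_sub_rpow_mul_rpow ha hb ht]
  have h1 := Real.Gamma_pos_of_pos ha
  have h2 := Real.Gamma_pos_of_pos hb
  have h3 := Real.Gamma_pos_of_pos (add_pos ha hb)
  positivity

theorem integrableOn_sub_rpow_mul_resolventKernel {γ lam t : ℝ} (hγ : 0 < γ) (ht : 0 < t) :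
    IntegrableOn (fun s => (t - s) ^ (γ - 1) * resolventKernel γ lam s) (Ioc 0 t) := by
  have hcont : Continuous fun s : ℝ => lam * Real.Gamma γ *
      mittagLefflerTwo γ (-(lam * Real.Gamma γ) * s ^ γ) :=
    continuous_const.mul ((continuous_mittagLefflerTwo hγ).comp
      (continuous_const.mul (Real.continuous_rpow_const hγ.le)))
  have hint := integrableOn_sub_rpow_mul_rpow hγ hγ ht
  rw [← integrableOn_Icc_iff_integrableOn_Ioc] at hint
  have := (hint.mul_continuousOn hcont.continuousOn isCompact_Icc).mono_set Ioc_subset_Icc_self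
  refine this.congr_fun (fun s hs => ?_) measurableSet_Ioc
  rw [resolventKernel_eq hγ hs.1]
  ring

/-- The kernel `r_λ` is the resolvent of `λ t^(γ-1)`. -/
theorem resolventKernel_add_integral {γ lam t : ℝ} (hγ : 0 < γ) (ht : 0 < t) :
    resolventKernel γ lam t + lam * ∫ s in Ioc 0 t, (t - s) ^ (γ - 1) * resolventKernel γ lam s =
      lam * t ^ (γ - 1) := by
  set c := lam * Real.Gamma γ with hc
  set x := -c * t ^ γ with hx
  have hG := Real.Gamma_pos_of_pos hγ
  have hsum (z : ℝ) : Summable fun n : ℕ => z ^ n / Real.Gamma (((n : ℝ) + 1) * γ) :=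
    Summable.of_norm_bounded (summable_pow_div_Gamma hγ (abs_nonneg z))
      fun n => norm_pow_div_Gamma_le hγ le_rfl n
  have hpow (n : ℕ) : (0 : ℝ) < ((n : ℝ) + 1) * γ := by positivity
  have hGn (n : ℕ) := Real.Gamma_pos_of_pos (hpow n)
  have hGn' (n : ℕ) : 0 < Real.Gamma (((n + 1 : ℕ) + 1 : ℝ) * γ) := by
    have := hGn (n + 1)
    push_cast at this ⊢
    exact this
  have htpow (s : ℝ) (hs : 0 < s) (n : ℕ) :
      s ^ (((n : ℝ) + 1) * γ - 1) = s ^ (γ - 1) * (s ^ γ) ^ n := by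
    rw [← Real.rpow_natCast (s ^ γ) n, ← Real.rpow_mul hs.le, ← Real.rpow_add hs]
    ring_nf
  set F : ℕ → ℝ → ℝ := fun n s =>
    c * (-c) ^ n / Real.Gamma (((n : ℝ) + 1) * γ) *
      ((t - s) ^ (γ - 1) * s ^ (((n : ℝ) + 1) * γ - 1)) with hF
  have hbeta (n : ℕ) : ∫ s in Ioc 0 t, (t - s) ^ (γ - 1) * s ^ (((n : ℝ) + 1) * γ - 1) =
      Real.Gamma γ * Real.Gamma (((n : ℝ) + 1) * γ) * t ^ (γ - 1) * (t ^ γ) ^ (n + 1) /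
        Real.Gamma (((n + 1 : ℕ) + 1 : ℝ) * γ) := by
    have h1 := htpow t ht (n + 1)
    push_cast at h1 ⊢
    rw [integral_sub_rpow_mul_rpow hγ (hpow n) ht,
      show γ + ((n : ℝ) + 1) * γ = ((n : ℝ) + 1 + 1) * γ by ring, h1]
    ring
  have hFint (n : ℕ) : Integrable (F n) (volume.restrict (Ioc 0 t)) :=
    (integrableOn_sub_rpow_mul_rpow hγ (hpow n) ht).const_mul _
  have hFval (n : ℕ) : ∫ s in Ioc 0 t, F n s = -(Real.Gamma γ * t ^ (γ - 1)) *
      (x ^ (n + 1) / Real.Gamma (((n + 1 : ℕ) + 1 : ℝ) * γ)) := by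
    have h1 := (hGn n).ne'
    have h2 := (hGn' n).ne'
    rw [hF, integral_const_mul, hbeta, hx, mul_pow, pow_succ (-c) n]
    field_simp
  have hFnorm (n : ℕ) : ∫ s in Ioc 0 t, ‖F n s‖ = Real.Gamma γ * t ^ (γ - 1) *
      (|x| ^ (n + 1) / Real.Gamma (((n + 1 : ℕ) + 1 : ℝ) * γ)) := by
    have h1 := (hGn n).ne'
    have h2 := (hGn' n).ne'
    have : ∫ s in Ioc 0 t, ‖F n s‖ = ∫ s in Ioc 0 t,
        |c| * |c| ^ n / Real.Gamma (((n : ℝ) + 1) * γ) *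
          ((t - s) ^ (γ - 1) * s ^ (((n : ℝ) + 1) * γ - 1)) := by
      refine setIntegral_congr_fun measurableSet_Ioc fun s hs => ?_
      have hs1 : 0 ≤ t - s := by linarith [hs.2]
      have hs2 : 0 < s := hs.1
      rw [hF]
      simp only [norm_mul, norm_div, norm_pow, norm_neg, Real.norm_eq_abs]
      rw [abs_of_pos (hGn n), abs_of_nonneg (Real.rpow_nonneg hs1 _),
        abs_of_nonneg (Real.rpow_nonneg hs2.le _)]
    have hxabs : |x| = |c| * t ^ γ := by
      rw [hx, abs_mul, abs_neg, abs_of_pos (Real.rpow_pos_of_pos ht γ)]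
    rw [this, integral_const_mul, hbeta, hxabs, mul_pow, pow_succ |c| n]
    field_simp
  have hFsum : Summable fun n => ∫ s in Ioc 0 t, ‖F n s‖ := by
    simp only [hFnorm]
    exact ((summable_nat_add_iff 1).2 (hsum |x|)).mul_left _
  have hseries := (hasSum_integral_of_summable_integral_norm hFint hFsum).tsum_eq
  have hcongr : ∫ s in Ioc 0 t, ∑' n, F n s =
      ∫ s in Ioc 0 t, (t - s) ^ (γ - 1) * resolventKernel γ lam s := by
    refine setIntegral_congr_fun measurableSet_Ioc fun s hs => ?_
    rw [resolventKernel_eq hγ hs.1, mittagLefflerTwo, ← tsum_mul_left, ← tsum_mul_left]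
    refine tsum_congr fun n => ?_
    rw [hF]
    simp only [htpow s hs.1 n, mul_pow]
    ring
  rw [← hcongr, ← hseries]
  simp only [hFval]
  rw [tsum_mul_left, resolventKernel_eq hγ ht, mittagLefflerTwo, ← hc, ← hx,
    (hsum x).tsum_eq_zero_add, hc]
  simp only [pow_zero, Nat.cast_zero, zero_add, one_mul]
  field_simp
  ring

theorem integral_Ioc_sub_rpow {γ u t : ℝ} (hγ : 0 < γ) (hut : u ≤ t) :
    ∫ s in Ioc u t, (t - s) ^ (γ - 1) = (t - u) ^ γ / γ := by
  rw [← intervalIntegral.integral_of_le hut,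
    intervalIntegral.integral_comp_sub_left (fun s => s ^ (γ - 1)) t,
    integral_rpow (Or.inl (by linarith))]
  simp [Real.zero_rpow hγ.ne']

theorem sub_rpow_mul_le {γ s t u : ℝ} (hγ : γ ≤ 1) (hs : 0 ≤ s) (hst : s < t) (htu : t ≤ u) :
    (u - s) ^ (γ - 1) * t ^ (γ - 1) ≤ u ^ (γ - 1) * (t - s) ^ (γ - 1) := by
  rw [← Real.mul_rpow (by linarith) (by linarith), ← Real.mul_rpow (by linarith) (by linarith)]
  refine Real.rpow_le_rpow_of_nonpos (by nlinarith) (by nlinarith) (by linarith)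

/-- Nonnegativity of the resolvent, from log-convexity of the kernel `t^(γ-1)`: at a first zero
`t₀` the resolvent equations at `t₀` and at a maximum of `r_λ` on `[τ, t₀]` contradict each other
when `τ` is close to `t₀`. -/
theorem resolventKernel_pos {γ lam t : ℝ} (hγ : 0 < γ) (hγ1 : γ ≤ 1) (hlam : 0 < lam)
    (ht : 0 < t) : 0 < resolventKernel γ lam t := by
  set r := resolventKernel γ lam with hr
  by_contra! hneg
  have hcont := continuousOn_resolventKernel hγ lam
  rw [← hr] at hcont
  obtain ⟨ε, hε, hεpos⟩ := mem_nhdsGT_iff_exists_Ioo_subset.1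
    (eventually_resolventKernel_pos hγ hlam)
  have hε0 : 0 < ε := hε
  have hlow : ∀ s, 0 < s → r s ≤ 0 → ε ≤ s := fun s hs hrs => by
    by_contra! hlt
    exact absurd (hεpos ⟨hs, hlt⟩) (not_lt.2 hrs)
  obtain ⟨t₀, ht₀, hrt₀, hbefore⟩ : ∃ t₀, 0 < t₀ ∧ r t₀ ≤ 0 ∧ ∀ s, 0 < s → s < t₀ → 0 < r s := by
    set S := Icc ε t ∩ r ⁻¹' Iic 0 with hS
    have hSclosed : IsCompact S := by
      refine isCompact_Icc.of_isClosed_subset ?_ inter_subset_left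
      exact (hcont.mono fun s hs => lt_of_lt_of_le hε0 hs.1).preimage_isClosed_of_isClosed
        isClosed_Icc isClosed_Iic
    obtain ⟨t₀, ht₀, hmin⟩ := hSclosed.exists_isLeast ⟨t, ⟨hlow t ht hneg, le_rfl⟩, hneg⟩
    refine ⟨t₀, hε0.trans_le ht₀.1.1, ht₀.2, fun s hs hst => ?_⟩
    by_contra! hrs
    exact absurd (hmin ⟨⟨hlow s hs hrs, hst.le.trans ht₀.1.2⟩, hrs⟩) (not_le.2 hst)
  set k : ℝ → ℝ := fun s => s ^ (γ - 1) with hk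
  have hkpos : ∀ s, 0 < s → 0 < k s := fun s hs => Real.rpow_pos_of_pos hs _
  obtain ⟨τ, hτ0, hτ, hsmall⟩ : ∃ τ, 0 < τ ∧ τ < t₀ ∧
      ∀ s ∈ Icc τ t₀, lam * (k s * ((t₀ - s) ^ γ / γ)) < k t₀ := by
    have hc : ContinuousAt (fun s => lam * (k s * ((t₀ - s) ^ γ / γ))) t₀ := by
      have h1 : ContinuousAt k t₀ := Real.continuousAt_rpow_const _ _ (Or.inl ht₀.ne')
      have h2 : Continuous fun s : ℝ => (t₀ - s) ^ γ / γ :=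
        ((Real.continuous_rpow_const hγ.le).comp (continuous_const.sub continuous_id)).div_const _
      exact continuousAt_const.mul (h1.mul h2.continuousAt)
    have hev := hc.eventually_lt_const (u := k t₀)
      (by simpa [Real.zero_rpow hγ.ne'] using hkpos t₀ ht₀)
    obtain ⟨δ, hδ, hball⟩ := Metric.eventually_nhds_iff.1 hev
    refine ⟨max (t₀ / 2) (t₀ - δ / 2), by positivity, max_lt (by linarith) (by linarith),
      fun s hs => hball ?_⟩
    have := (le_max_right _ _).trans hs.1
    rw [Real.dist_eq, abs_lt]
    constructor <;> linarith [hs.2]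
  obtain ⟨m, hm, hmax⟩ := isCompact_Icc.exists_isMaxOn (nonempty_Icc.2 hτ.le)
    (hcont.mono fun s hs => hτ0.trans_le hs.1 : ContinuousOn r (Icc τ t₀))
  have hmt₀ : m < t₀ := lt_of_le_of_ne hm.2 fun heq => by
    have h1 : r τ ≤ r m := hmax ⟨le_rfl, hτ.le⟩
    rw [heq] at h1
    linarith [hbefore τ hτ0 hτ]
  have hm0 : 0 < m := hτ0.trans_le hm.1
  have hrm : 0 < r m := hbefore m hm0 hmt₀
  have heq₀ : r t₀ + lam * ∫ s in Ioc 0 t₀, k (t₀ - s) * r s = lam * k t₀ :=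
    resolventKernel_add_integral hγ ht₀
  have heqm : r m + lam * ∫ s in Ioc 0 m, k (m - s) * r s = lam * k m :=
    resolventKernel_add_integral hγ hm0
  have hint₀ : IntegrableOn (fun s => k (t₀ - s) * r s) (Ioc 0 t₀) :=
    integrableOn_sub_rpow_mul_resolventKernel hγ ht₀
  have hintm : IntegrableOn (fun s => k (m - s) * r s) (Ioc 0 m) :=
    integrableOn_sub_rpow_mul_resolventKernel hγ hm0
  rw [← Ioc_union_Ioc_eq_Ioc hm0.le hmt₀.le, setIntegral_union (Ioc_disjoint_Ioc_of_le le_rfl)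
    measurableSet_Ioc (hint₀.mono_set (Ioc_subset_Ioc_right hmt₀.le))
    (hint₀.mono_set (Ioc_subset_Ioc_left hm0.le))] at heq₀
  have hfirst : (∫ s in Ioc 0 m, k (t₀ - s) * r s) * k m ≤
      k t₀ * ∫ s in Ioc 0 m, k (m - s) * r s := by
    rw [integral_Ioc_eq_integral_Ioo, integral_Ioc_eq_integral_Ioo, ← integral_mul_const,
      ← integral_const_mul]
    refine setIntegral_mono_on
      ((hint₀.mono_set (Ioo_subset_Ioc_self.trans (Ioc_subset_Ioc_right hmt₀.le))).mul_const _)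
      ((hintm.mono_set Ioo_subset_Ioc_self).const_mul _) measurableSet_Ioo fun s hs => ?_
    have h1 := mul_le_mul_of_nonneg_right (sub_rpow_mul_le hγ1 hs.1.le hs.2 hmt₀.le)
      (hbefore s hs.1 (hs.2.trans hmt₀)).le
    simp only [hk]
    linarith
  have hsecond : ∫ s in Ioc m t₀, k (t₀ - s) * r s ≤ (t₀ - m) ^ γ / γ * r m := by
    rw [← integral_Ioc_sub_rpow hγ hmt₀.le, ← integral_mul_const]
    have hkint : IntegrableOn (fun s => k (t₀ - s)) (Ioc m t₀) := by
      refine Integrable.of_integral_ne_zero ?_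
      rw [integral_Ioc_sub_rpow hγ hmt₀.le]
      have : 0 < t₀ - m := by linarith
      positivity
    refine setIntegral_mono_on (hint₀.mono_set (Ioc_subset_Ioc_left hm0.le))
      (hkint.mul_const _) measurableSet_Ioc fun s hs => ?_
    exact mul_le_mul_of_nonneg_left (hmax ⟨hm.1.trans hs.1.le, hs.2⟩)
      (Real.rpow_nonneg (by linarith [hs.2]) _)
  have hs := hsmall m hm
  have hkm := hkpos m hm0
  set I := ∫ s in Ioc 0 m, k (t₀ - s) * r s
  set J := ∫ s in Ioc m t₀, k (t₀ - s) * r s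
  set L := ∫ s in Ioc 0 m, k (m - s) * r s
  have e1 : lam * (I * k m) ≤ lam * (k t₀ * L) := mul_le_mul_of_nonneg_left hfirst hlam.le
  have e2 : lam * k m * J ≤ lam * k m * ((t₀ - m) ^ γ / γ * r m) :=
    mul_le_mul_of_nonneg_left hsecond (by positivity)
  have e3 := mul_lt_mul_of_pos_right hs hrm
  have e4 : 0 ≤ (lam * (I + J) - lam * k t₀) * k m :=
    mul_nonneg (by linarith) hkm.le
  have e5 : k t₀ * (r m + lam * L) = k t₀ * (lam * k m) := by rw [heqm]
  nlinarith

open scoped ENNReal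

section LConvolution

variable {f g k : ℝ → ℝ≥0∞}

theorem lconvolution_add_right (hk : Measurable k) (hf : Measurable f) :
    k ⋆ₗ (f + g) = k ⋆ₗ f + k ⋆ₗ g := by
  ext t
  simp only [lconvolution_def, Pi.add_apply, mul_add]
  exact lintegral_add_left (by fun_prop) _

theorem lconvolution_add_left (hk : Measurable k) (hf : Measurable f) :
    (f + g) ⋆ₗ k = f ⋆ₗ k + g ⋆ₗ k := by
  ext t
  simp only [lconvolution_def, Pi.add_apply, add_mul]
  exact lintegral_add_left (by fun_prop) _

theorem lconvolution_eq_setLIntegral (hf : ∀ t ≤ 0, f t = 0) (hk : ∀ t ≤ 0, k t = 0) (t : ℝ) :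
    (k ⋆ₗ f) t = ∫⁻ s in Ioo 0 t, k (t - s) * f s := by
  rw [lconvolution_comm, lconvolution_def, ← lintegral_indicator measurableSet_Ioo]
  refine lintegral_congr fun s => ?_
  by_cases hs : s ∈ Ioo 0 t
  · rw [indicator_of_mem hs, mul_comm, neg_add_eq_sub]
  · rw [indicator_of_notMem hs]
    by_cases hs0 : s ≤ 0
    · rw [hf s hs0, zero_mul]
    · have : t ≤ s := by
        by_contra! hlt
        exact hs ⟨not_le.1 hs0, hlt⟩
      rw [hk (-s + t) (by linarith), mul_zero]

theorem lconvolution_eq_zero (hf : ∀ t ≤ 0, f t = 0) (hk : ∀ t ≤ 0, k t = 0) {t : ℝ} (ht : t ≤ 0) :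
    (k ⋆ₗ f) t = 0 := by
  rw [lconvolution_eq_setLIntegral hf hk, Ioo_eq_empty_of_le ht]
  simp

theorem lconvolution_congr_of_lt {T : ℝ} (hf : ∀ t ≤ 0, f t = 0) (hg : ∀ t ≤ 0, g t = 0)
    (hk : ∀ t ≤ 0, k t = 0) (hfg : ∀ᵐ t ∂volume.restrict (Ioo 0 T), f t = g t) {t : ℝ}
    (ht : t < T) : (k ⋆ₗ f) t = (k ⋆ₗ g) t := by
  rw [lconvolution_eq_setLIntegral hf hk, lconvolution_eq_setLIntegral hg hk]
  refine lintegral_congr_ae ?_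
  filter_upwards [ae_restrict_of_ae_restrict_of_subset (Ioo_subset_Ioo_right ht.le) hfg] with s hs
  rw [hs]

/-- The exponential weight `e^{-σt}`, as an `ℝ≥0∞`-valued function. -/
noncomputable def expWeight (σ t : ℝ) : ℝ≥0∞ := ENNReal.ofReal (Real.exp (-(σ * t)))

theorem measurable_expWeight (σ : ℝ) : Measurable (expWeight σ) := by
  unfold expWeight
  fun_prop

theorem expWeight_ne_zero (σ t : ℝ) : expWeight σ t ≠ 0 := by
  simp [expWeight, Real.exp_pos]

theorem expWeight_ne_top (σ t : ℝ) : expWeight σ t ≠ ∞ := ENNReal.ofReal_ne_top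

theorem expWeight_add (σ s t : ℝ) : expWeight σ (s + t) = expWeight σ s * expWeight σ t := by
  rw [expWeight, expWeight, expWeight, ← ENNReal.ofReal_mul (Real.exp_pos _).le, ← Real.exp_add]
  ring_nf

theorem lintegral_expWeight_mul_lconvolution (σ : ℝ) (hf : Measurable f) (hk : Measurable k) :
    ∫⁻ t, expWeight σ t * (k ⋆ₗ f) t =
      (∫⁻ t, expWeight σ t * k t) * ∫⁻ t, expWeight σ t * f t := by
  have he := measurable_expWeight σ
  have h1 : ∀ t, expWeight σ t * (k ⋆ₗ f) t =
      ∫⁻ s, (expWeight σ s * k s) * (expWeight σ (-s + t) * f (-s + t)) := fun t => by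
    rw [lconvolution_def, ← lintegral_const_mul _ (by fun_prop)]
    refine lintegral_congr fun s => ?_
    have := expWeight_add σ s (-s + t)
    rw [add_neg_cancel_left] at this
    rw [this]
    ring
  simp only [h1]
  rw [lintegral_lintegral_swap (by fun_prop), ← lintegral_mul_const _ (by fun_prop)]
  refine lintegral_congr fun s => ?_
  rw [lintegral_const_mul _ (by fun_prop),
    lintegral_add_left_eq_self (fun t => expWeight σ t * f t) (-s)]

theorem ae_ne_top_of_lintegral_expWeight_mul {σ : ℝ} (hf : Measurable f)
    (hfin : ∫⁻ t, expWeight σ t * f t ≠ ∞) : ∀ᵐ t, f t ≠ ∞ := by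
  filter_upwards [ae_lt_top ((measurable_expWeight σ).mul hf) hfin] with t ht htop
  simp [htop, ENNReal.mul_top (expWeight_ne_zero σ t)] at ht

theorem setLIntegral_Ioo_ne_top_of_lintegral_expWeight_mul {σ : ℝ} (hσ : 0 ≤ σ) (T : ℝ)
    (hfin : ∫⁻ t, expWeight σ t * f t ≠ ∞) : ∫⁻ t in Ioo 0 T, f t ≠ ∞ := by
  have hle : ∫⁻ t in Ioo 0 T, expWeight σ T * f t ≤ ∫⁻ t, expWeight σ t * f t := by
    refine (setLIntegral_mono' measurableSet_Ioo fun t ht => ?_).trans (setLIntegral_le_lintegral _ _)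
    gcongr
    exact ENNReal.ofReal_le_ofReal (Real.exp_le_exp.2
      (neg_le_neg (mul_le_mul_of_nonneg_left ht.2.le hσ)))
  rw [lintegral_const_mul' _ _ (expWeight_ne_top σ T)] at hle
  intro htop
  rw [htop, ENNReal.mul_top (expWeight_ne_zero σ T)] at hle
  exact hfin (top_le_iff.1 hle)

theorem lintegral_expWeight_mul_ne_top {σ T : ℝ} (hσ : 0 ≤ σ) (hsupp : ∀ t ∉ Ioo 0 T, f t = 0)
    (hfin : ∫⁻ t in Ioo 0 T, f t ≠ ∞) : ∫⁻ t, expWeight σ t * f t ≠ ∞ := by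
  refine ne_top_of_le_ne_top hfin ?_
  rw [← lintegral_indicator measurableSet_Ioo]
  refine lintegral_mono fun t => ?_
  by_cases ht : t ∈ Ioo 0 T
  · rw [indicator_of_mem ht]
    refine mul_le_of_le_one_left zero_le ?_
    rw [expWeight, ENNReal.ofReal_le_one, Real.exp_le_one_iff]
    have := mul_nonneg hσ ht.1.le
    linarith
  · simp [hsupp t ht]

/-- The Neumann series solves `Y = W + R ⋆ (a Y)`. -/
theorem exists_eq_add_lconvolution_mul {R W a : ℝ → ℝ≥0∞} {σ : ℝ} (hR : Measurable R)
    (hWm : Measurable W) (ha : Measurable a) (hR0 : ∀ t ≤ 0, R t = 0) (hW0 : ∀ t ≤ 0, W t = 0)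
    (ha2 : ∀ t, a t ≤ 2) (hRσ : ∫⁻ t, expWeight σ t * R t ≤ 1 / 4)
    (hWσ : ∫⁻ t, expWeight σ t * W t ≠ ∞) :
    ∃ Y : ℝ → ℝ≥0∞, Measurable Y ∧ (∀ t ≤ 0, Y t = 0) ∧ ∫⁻ t, expWeight σ t * Y t ≠ ∞ ∧
      Y = W + R ⋆ₗ (a * Y) := by
  have he := measurable_expWeight σ
  obtain ⟨S, hSzero, hSsucc⟩ : ∃ S : ℕ → ℝ → ℝ≥0∞, S 0 = W ∧ ∀ n, S (n + 1) = R ⋆ₗ (a * S n) :=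
    ⟨fun n => (fun f => R ⋆ₗ (a * f))^[n] W, rfl, fun n => Function.iterate_succ_apply' _ _ _⟩
  have hSm (n : ℕ) : Measurable (S n) := by
    induction n with
    | zero => rwa [hSzero]
    | succ n ih => rw [hSsucc]; exact measurable_lconvolution _ hR (ha.mul ih)
  have hS0 (n : ℕ) : ∀ t ≤ 0, S n t = 0 := by
    induction n with
    | zero => rwa [hSzero]
    | succ n ih =>
      rw [hSsucc]
      exact fun t ht => lconvolution_eq_zero (fun t ht => by simp [ih t ht]) hR0 ht
  have hSσ (n : ℕ) : ∫⁻ t, expWeight σ t * S n t ≤ (1 / 2) ^ n * ∫⁻ t, expWeight σ t * W t := by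
    induction n with
    | zero => simp [hSzero]
    | succ n ih =>
      rw [hSsucc, lintegral_expWeight_mul_lconvolution σ (ha.mul (hSm n)) hR]
      calc (∫⁻ t, expWeight σ t * R t) * ∫⁻ t, expWeight σ t * (a * S n) t
          ≤ 1 / 4 * ∫⁻ t, 2 * (expWeight σ t * S n t) := by
            refine mul_le_mul' hRσ (lintegral_mono fun t => ?_)
            rw [Pi.mul_apply, mul_left_comm]
            exact mul_le_mul_left (ha2 t) _
        _ = 1 / 2 * ∫⁻ t, expWeight σ t * S n t := by
            rw [lintegral_const_mul _ (he.fun_mul (hSm n)), ← mul_assoc]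
            congr 1
            rw [show (4 : ℝ≥0∞) = 2 * 2 by norm_num, one_div, one_div,
              ENNReal.mul_inv (by simp) (by simp), mul_assoc,
              ENNReal.inv_mul_cancel (by simp) (by simp), mul_one]
        _ ≤ 1 / 2 * ((1 / 2) ^ n * ∫⁻ t, expWeight σ t * W t) := by gcongr
        _ = _ := by rw [pow_succ]; ring
  set Y : ℝ → ℝ≥0∞ := fun t => ∑' n, S n t with hY
  have hYm : Measurable Y := Measurable.tsum hSm
  have hYeq : Y = W + R ⋆ₗ (a * Y) := by
    ext t
    have h1 : (R ⋆ₗ (a * Y)) t = ∑' n, S (n + 1) t := by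
      simp only [hSsucc, lconvolution_def]
      rw [← lintegral_tsum (f := fun n y => R y * (a * S n) (-y + t)) fun n => (hR.fun_mul ((ha.mul (hSm n)).comp
        (measurable_id.neg.add_const t))).aemeasurable]
      refine lintegral_congr fun s => ?_
      simp only [Pi.mul_apply, hY, ENNReal.tsum_mul_left]
    rw [Pi.add_apply, h1, ← hSzero]
    exact tsum_eq_zero_add' (f := fun n => S n t) ENNReal.summable
  refine ⟨Y, hYm, fun t ht => by simp [hY, hS0 _ t ht], ?_, hYeq⟩
  · have h1 : ∫⁻ t, expWeight σ t * Y t ≤ ∑' n : ℕ, (1 / 2) ^ n * ∫⁻ t, expWeight σ t * W t := by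
      simp only [hY, ← ENNReal.tsum_mul_left]
      rw [lintegral_tsum fun n => (he.fun_mul (hSm n)).aemeasurable]
      exact ENNReal.tsum_le_tsum hSσ
    rw [ENNReal.tsum_mul_right, ENNReal.tsum_geometric, one_div, ENNReal.one_sub_inv_two,
      inv_inv] at h1
    exact ne_top_of_le_ne_top (ENNReal.mul_ne_top (by simp) hWσ) h1

/-- Existence for `y + L ⋆ ((1 - a) y) = h` with positive data, written without subtraction, where
`R` is the resolvent of the kernel `L` and `h - R ⋆ h > 0`. -/
theorem exists_causal_solution {L R H a : ℝ → ℝ≥0∞} {σ T : ℝ} (hL : Measurable L)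
    (hR : Measurable R) (hH : Measurable H) (ha : Measurable a) (hL0 : ∀ t ≤ 0, L t = 0)
    (hR0 : ∀ t ≤ 0, R t = 0) (hH0 : ∀ t ≤ 0, H t = 0) (hres : R + L ⋆ₗ R = L)
    (ha2 : ∀ t, a t ≤ 2) (hLσ : ∫⁻ t, expWeight σ t * L t ≤ 1 / 4)
    (hHσ : ∫⁻ t, expWeight σ t * H t ≠ ∞)
    (hpos : ∀ᵐ t ∂volume.restrict (Ioo 0 T), (R ⋆ₗ H) t < H t) :
    ∃ Y : ℝ → ℝ≥0∞, Measurable Y ∧ (∀ t ≤ 0, Y t = 0) ∧ ∫⁻ t, expWeight σ t * Y t ≠ ∞ ∧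
      (∀ᵐ t ∂volume.restrict (Ioo 0 T), 0 < Y t) ∧
      ∀ᵐ t ∂volume.restrict (Ioo 0 T), Y t + (L ⋆ₗ Y) t = H t + (L ⋆ₗ (a * Y)) t := by
  have hRL : R ≤ L := by rw [← hres]; exact le_self_add
  have hRσ : ∫⁻ t, expWeight σ t * R t ≤ 1 / 4 :=
    (lintegral_mono fun t => mul_le_mul_right (hRL t) _).trans hLσ
  set W : ℝ → ℝ≥0∞ := fun t => H t - (R ⋆ₗ H) t with hW
  have hWm : Measurable W := hH.sub (measurable_lconvolution _ hR hH)
  have hW0 : ∀ t ≤ 0, W t = 0 := fun t ht => by simp [hW, hH0 t ht]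
  have hWσ : ∫⁻ t, expWeight σ t * W t ≠ ∞ :=
    ne_top_of_le_ne_top hHσ (lintegral_mono fun t => mul_le_mul_right tsub_le_self _)
  obtain ⟨Y, hYm, hY0, hYσ, hYeq⟩ :=
    exists_eq_add_lconvolution_mul hR hWm ha hR0 hW0 ha2 hRσ hWσ
  refine ⟨Y, hYm, hY0, hYσ, ?_, ?_⟩
  · filter_upwards [hpos] with t ht
    rw [hYeq]
    exact (tsub_pos_of_lt ht).trans_le le_self_add
  · have hRH : Measurable (R ⋆ₗ H) := measurable_lconvolution _ hR hH
    have hHW : ∀ᵐ t ∂volume.restrict (Ioo 0 T), H t = (W + R ⋆ₗ H) t := by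
      filter_upwards [hpos] with t ht
      exact (tsub_add_cancel_of_le ht.le).symm
    have hLconv (F : ℝ → ℝ≥0∞) (hF : Measurable F) : L ⋆ₗ F = R ⋆ₗ F + L ⋆ₗ (R ⋆ₗ F) := by
      rw [lconvolution_assoc hL hR hF, ← lconvolution_add_left hF hR, hres]
    have hLH : ∫⁻ t, expWeight σ t * (L ⋆ₗ H) t ≠ ∞ := by
      rw [lintegral_expWeight_mul_lconvolution σ hH hL]
      exact ENNReal.mul_ne_top (ne_top_of_le_ne_top (by simp) hLσ) hHσ
    have hLHfin := ae_ne_top_of_lintegral_expWeight_mul (measurable_lconvolution _ hL hH) hLH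
    filter_upwards [hHW, ae_restrict_of_ae hLHfin, ae_restrict_mem measurableSet_Ioo]
      with t ht hfin htT
    have h1 : (L ⋆ₗ H) t = (L ⋆ₗ W) t + (L ⋆ₗ (R ⋆ₗ H)) t := by
      have := lconvolution_congr_of_lt (k := L) hH0 (g := W + R ⋆ₗ H)
        (fun t ht => by simp [hW0 t ht, lconvolution_eq_zero hH0 hR0 ht]) hL0 hHW htT.2
      rw [this, lconvolution_add_right hL hWm, Pi.add_apply]
    have h2 : (L ⋆ₗ H) t = (R ⋆ₗ H) t + (L ⋆ₗ (R ⋆ₗ H)) t := congrFun (hLconv H hH) t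
    have h3 : (R ⋆ₗ H) t = (L ⋆ₗ W) t := by
      have hne : (L ⋆ₗ (R ⋆ₗ H)) t ≠ ∞ := ne_top_of_le_ne_top hfin (by rw [h1]; exact le_add_self)
      exact (ENNReal.add_left_inj hne).1 (h2.symm.trans h1)
    have haY : Measurable (a * Y) := ha.mul hYm
    have h4 : (L ⋆ₗ Y) t = (L ⋆ₗ W) t + (L ⋆ₗ (R ⋆ₗ (a * Y))) t := by
      conv_lhs => rw [hYeq]
      rw [lconvolution_add_right hL hWm, Pi.add_apply]
    have h5 : (L ⋆ₗ (a * Y)) t = (R ⋆ₗ (a * Y)) t + (L ⋆ₗ (R ⋆ₗ (a * Y))) t :=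
      congrFun (hLconv (a * Y) haY) t
    have h6 : Y t = W t + (R ⋆ₗ (a * Y)) t := congrFun hYeq t
    rw [h4, h5, h6, ht, Pi.add_apply, h3]
    ring

theorem ae_eq_zero_of_le_lconvolution {L D : ℝ → ℝ≥0∞} {σ : ℝ} (hL : Measurable L)
    (hD : Measurable D) (hLσ : ∫⁻ t, expWeight σ t * L t ≤ 1 / 4)
    (hDσ : ∫⁻ t, expWeight σ t * D t ≠ ∞) (hle : ∀ᵐ t, D t ≤ (L ⋆ₗ D) t) :
    ∀ᵐ t, D t = 0 := by
  have he := measurable_expWeight σ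
  have h1 : ∫⁻ t, expWeight σ t * D t ≤ 1 / 4 * ∫⁻ t, expWeight σ t * D t := by
    calc ∫⁻ t, expWeight σ t * D t ≤ ∫⁻ t, expWeight σ t * (L ⋆ₗ D) t :=
          lintegral_mono_ae (hle.mono fun t ht => mul_le_mul_right ht _)
      _ = (∫⁻ t, expWeight σ t * L t) * ∫⁻ t, expWeight σ t * D t :=
          lintegral_expWeight_mul_lconvolution σ hD hL
      _ ≤ _ := mul_le_mul_left hLσ _
  have h2 : ∫⁻ t, expWeight σ t * D t = 0 := by
    by_contra hne
    have h3 : 1 / 4 * ∫⁻ t, expWeight σ t * D t < 1 * ∫⁻ t, expWeight σ t * D t :=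
      ENNReal.mul_lt_mul_left hne hDσ (by
        rw [one_div]; exact ENNReal.inv_lt_one.2 (by norm_num))
    rw [one_mul] at h3
    exact absurd h1 (not_le.2 h3)
  rw [lintegral_eq_zero_iff (he.fun_mul hD)] at h2
  filter_upwards [h2] with t ht
  exact (mul_eq_zero.1 ht).resolve_left (expWeight_ne_zero σ t)

end LConvolution

/-- The extension by zero of a kernel on `(0,∞)`, as an `ℝ≥0∞`-valued function. -/
noncomputable def causalExtension (q : ℝ → ℝ) : ℝ → ℝ≥0∞ :=
  (Ioi 0).indicator fun t => ENNReal.ofReal (q t)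

theorem causalExtension_of_pos (q : ℝ → ℝ) {t : ℝ} (ht : 0 < t) :
    causalExtension q t = ENNReal.ofReal (q t) := indicator_of_mem (mem_Ioi.2 ht) _

theorem causalExtension_of_nonpos (q : ℝ → ℝ) (t : ℝ) (ht : t ≤ 0) : causalExtension q t = 0 :=
  indicator_of_notMem (notMem_Ioi.2 ht) _

theorem measurable_causalExtension {q : ℝ → ℝ} (hq : ContinuousOn q (Ioi 0)) :
    Measurable (causalExtension q) := by
  have h1 : Measurable ((Ioi 0).indicator q) := by
    classical
    rw [← piecewise_eq_indicator]
    exact hq.measurable_piecewise continuousOn_const measurableSet_Ioi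
  have h2 : causalExtension q = fun t => ENNReal.ofReal ((Ioi 0).indicator q t) := by
    ext t
    by_cases ht : t ∈ Ioi 0 <;> simp [causalExtension, ht]
  rw [h2]
  exact h1.ennreal_ofReal

section CausalIntegral

variable {q f : ℝ → ℝ} {F : ℝ → ℝ≥0∞} {T t : ℝ}

theorem lintegral_enorm_eq_lconvolution (hq0 : ∀ t, 0 < t → 0 ≤ q t) (hF0 : ∀ t ≤ 0, F t = 0)
    (hfF : ∀ᵐ s ∂volume.restrict (Ioo 0 T), ‖f s‖ₑ = F s) (ht : t < T) :
    ∫⁻ s in Ioo 0 t, ‖q (t - s) * f s‖ₑ = (causalExtension q ⋆ₗ F) t := by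
  rw [lconvolution_eq_setLIntegral hF0 (causalExtension_of_nonpos q)]
  refine lintegral_congr_ae ?_
  filter_upwards [ae_restrict_of_ae_restrict_of_subset (Ioo_subset_Ioo_right ht.le) hfF,
    ae_restrict_mem measurableSet_Ioo] with s hs hst
  have hts : 0 < t - s := by linarith [hst.2]
  rw [enorm_mul, hs, causalExtension_of_pos q hts, Real.enorm_of_nonneg (hq0 _ hts)]

theorem integrableOn_of_lconvolution_ne_top (hq : ContinuousOn q (Ioi 0))
    (hq0 : ∀ t, 0 < t → 0 ≤ q t)
    (hf : AEStronglyMeasurable f (volume.restrict (Ioo 0 T))) (hF0 : ∀ t ≤ 0, F t = 0)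
    (hfF : ∀ᵐ s ∂volume.restrict (Ioo 0 T), ‖f s‖ₑ = F s) (ht : t < T)
    (hfin : (causalExtension q ⋆ₗ F) t ≠ ∞) :
    IntegrableOn (fun s => q (t - s) * f s) (Ioo 0 t) := by
  refine ⟨AEStronglyMeasurable.mul ?_ (hf.mono_set (Ioo_subset_Ioo_right ht.le)), ?_⟩
  · refine ContinuousOn.aestronglyMeasurable ?_ measurableSet_Ioo
    exact hq.comp (by fun_prop) fun s hs => sub_pos.2 hs.2
  · rw [hasFiniteIntegral_iff_enorm, lintegral_enorm_eq_lconvolution hq0 hF0 hfF ht]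
    exact hfin.lt_top

theorem integral_eq_toReal_lconvolution (hq : ContinuousOn q (Ioi 0))
    (hq0 : ∀ t, 0 < t → 0 ≤ q t)
    (hf : AEStronglyMeasurable f (volume.restrict (Ioo 0 T))) (hF0 : ∀ t ≤ 0, F t = 0)
    (hf0 : ∀ᵐ s ∂volume.restrict (Ioo 0 T), 0 ≤ f s)
    (hfF : ∀ᵐ s ∂volume.restrict (Ioo 0 T), ‖f s‖ₑ = F s) (ht : t < T) :
    ∫ s in Ioo 0 t, q (t - s) * f s = ((causalExtension q ⋆ₗ F) t).toReal := by
  have hmeas : AEStronglyMeasurable (fun s => q (t - s) * f s) (volume.restrict (Ioo 0 t)) := by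
    refine AEStronglyMeasurable.mul ?_ (hf.mono_set (Ioo_subset_Ioo_right ht.le))
    refine ContinuousOn.aestronglyMeasurable ?_ measurableSet_Ioo
    exact hq.comp (by fun_prop) fun s hs => sub_pos.2 hs.2
  rw [← lintegral_enorm_eq_lconvolution hq0 hF0 hfF ht, ← integral_norm_eq_lintegral_enorm hmeas]
  refine integral_congr_ae ?_
  filter_upwards [ae_restrict_of_ae_restrict_of_subset (Ioo_subset_Ioo_right ht.le) hf0,
    ae_restrict_mem measurableSet_Ioo] with s hs hst
  exact (Real.norm_of_nonneg (mul_nonneg (hq0 _ (by linarith [hst.2])) hs)).symm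

end CausalIntegral

/-- The resolvent equation for the causal extensions. -/
theorem causalExtension_resolventKernel_add {γ lam : ℝ} (hγ : 0 < γ) (hγ1 : γ ≤ 1)
    (hlam : 0 < lam) :
    causalExtension (resolventKernel γ lam) + causalExtension (fun t => lam * t ^ (γ - 1)) ⋆ₗ
      causalExtension (resolventKernel γ lam) = causalExtension fun t => lam * t ^ (γ - 1) := by
  ext t
  rw [Pi.add_apply]
  rcases le_or_gt t 0 with ht | ht
  · rw [lconvolution_eq_zero (causalExtension_of_nonpos _) (causalExtension_of_nonpos _) ht,
      causalExtension_of_nonpos _ t ht, causalExtension_of_nonpos _ t ht, add_zero]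
  have hrpos : ∀ s, 0 < s → 0 < resolventKernel γ lam s := fun s hs =>
    resolventKernel_pos hγ hγ1 hlam hs
  have hq0 : ∀ s : ℝ, 0 < s → 0 ≤ lam * s ^ (γ - 1) := fun s hs => by positivity
  have hnn : ∀ s ∈ Ioo 0 t, 0 ≤ (t - s) ^ (γ - 1) * resolventKernel γ lam s := fun s hs =>
    mul_nonneg (Real.rpow_nonneg (by linarith [hs.2]) _) (hrpos s hs.1).le
  have hint : IntegrableOn (fun s => lam * (t - s) ^ (γ - 1) * resolventKernel γ lam s)
      (Ioo 0 t) := by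
    have := ((integrableOn_sub_rpow_mul_resolventKernel (lam := lam) hγ ht).mono_set
      Ioo_subset_Ioc_self).const_mul lam
    simp only [mul_assoc]
    exact this
  have hconv := lintegral_enorm_eq_lconvolution (q := fun t => lam * t ^ (γ - 1))
    (f := resolventKernel γ lam) (F := causalExtension (resolventKernel γ lam)) (T := t + 1)
    (t := t) hq0 (causalExtension_of_nonpos _)
    (ae_restrict_of_forall_mem measurableSet_Ioo fun s hs => by
      rw [causalExtension_of_pos _ hs.1, Real.enorm_of_nonneg (hrpos s hs.1).le]) (by linarith)
  have hval : ∫⁻ s in Ioo 0 t, ‖lam * (t - s) ^ (γ - 1) * resolventKernel γ lam s‖ₑ =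
      ENNReal.ofReal (lam * ∫ s in Ioc 0 t, (t - s) ^ (γ - 1) * resolventKernel γ lam s) := by
    rw [← ofReal_integral_norm_eq_lintegral_enorm hint, integral_Ioc_eq_integral_Ioo,
      ← integral_const_mul]
    congr 1
    refine setIntegral_congr_fun measurableSet_Ioo fun s hs => ?_
    have := mul_nonneg hlam.le (hnn s hs)
    rw [mul_assoc, Real.norm_of_nonneg this]
  rw [← hconv, hval, causalExtension_of_pos _ ht, causalExtension_of_pos _ ht,
    ← ENNReal.ofReal_add (hrpos t ht).le, resolventKernel_add_integral hγ ht]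
  refine mul_nonneg hlam.le (setIntegral_nonneg measurableSet_Ioc fun s hs => ?_)
  exact mul_nonneg (Real.rpow_nonneg (by linarith [hs.2]) _) (hrpos s hs.1).le

theorem exists_lintegral_expWeight_mul_rpow_le {γ lam : ℝ} (hγ : 0 < γ) (hlam : 0 < lam) :
    ∃ σ, 0 < σ ∧
      ∫⁻ t, expWeight σ t * causalExtension (fun t => lam * t ^ (γ - 1)) t ≤ 1 / 4 := by
  have hG := Real.Gamma_pos_of_pos hγ
  set b := 1 / (4 * (lam * Real.Gamma γ)) with hb
  have hb0 : 0 < b := by positivity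
  refine ⟨(b ^ (1 / γ))⁻¹, by positivity, ?_⟩
  set σ := (b ^ (1 / γ))⁻¹ with hσ
  have hσ0 : 0 < σ := by positivity
  have hval := Real.integral_rpow_mul_exp_neg_mul_Ioi hγ hσ0
  have hbγ : (1 / σ) ^ γ = b := by
    rw [hσ, one_div, inv_inv, ← Real.rpow_mul hb0.le, one_div_mul_cancel hγ.ne', Real.rpow_one]
  rw [hbγ] at hval
  have hint : IntegrableOn (fun t => t ^ (γ - 1) * Real.exp (-(σ * t))) (Ioi 0) :=
    Integrable.of_integral_ne_zero (by rw [hval]; positivity)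
  have h1 : ∫⁻ t, expWeight σ t * causalExtension (fun t => lam * t ^ (γ - 1)) t =
      ∫⁻ t in Ioi 0, ENNReal.ofReal (lam * (t ^ (γ - 1) * Real.exp (-(σ * t)))) := by
    rw [← lintegral_indicator measurableSet_Ioi]
    refine lintegral_congr fun t => ?_
    by_cases ht : t ∈ Ioi (0 : ℝ)
    · rw [indicator_of_mem ht, causalExtension_of_pos _ ht, expWeight,
        ← ENNReal.ofReal_mul (Real.exp_pos _).le]
      ring_nf
    · rw [indicator_of_notMem ht, causalExtension_of_nonpos _ t (not_lt.1 ht), mul_zero]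
  rw [h1, ← ofReal_integral_eq_lintegral_ofReal (hint.const_mul lam), integral_const_mul, hval]
  · have : lam * (b * Real.Gamma γ) = 1 / 4 := by
      rw [hb]
      field_simp
    rw [this, ENNReal.ofReal_div_of_pos (by norm_num)]
    simp
  · refine ae_restrict_of_forall_mem measurableSet_Ioi fun t ht => ?_
    have : (0 : ℝ) < t := ht
    positivity

/-- If `h ∈ L¹(0,T)` is a.e. positive and satisfies
`h(t) − ∫₀ᵗ r_λ(t−s) h(s) ds > 0` a.e. for every `λ > 0`, and `v ∈ L^∞(0,T)`, then
the Volterra equation `y(t) + ∫₀ᵗ (t−s)^(γ−1) v(s) y(s) ds = h(t)` has a unique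
solution `y ∈ L¹(0,T)`, and `y > 0` a.e. -/
theorem volterra_resolvent_positivity
    (γ T : ℝ) (hγ : γ ∈ Set.Ioo (0:ℝ) 1) (hT : 0 < T)
    (h : ℝ → ℝ)
    (hh_int : IntegrableOn h (Set.Ioo 0 T))
    (hh_pos : ∀ᵐ t ∂volume.restrict (Set.Ioo 0 T), 0 < h t)
    (hh_res : ∀ lam : ℝ, 0 < lam →
      ∀ᵐ t ∂volume.restrict (Set.Ioo 0 T),
        0 < h t - ∫ s in (0:ℝ)..t, resolventKernel γ lam (t - s) * h s)
    (v : ℝ → ℝ) (hv_meas : Measurable v)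
    (C : ℝ) (hv_bdd : ∀ᵐ t ∂volume.restrict (Set.Ioo 0 T), |v t| ≤ C) :
    ∃ y : ℝ → ℝ, IntegrableOn y (Set.Ioo 0 T) ∧
      (∀ᵐ t ∂volume.restrict (Set.Ioo 0 T),
        y t + ∫ s in (0:ℝ)..t, (t - s) ^ (γ - 1) * v s * y s = h t) ∧
      (∀ᵐ t ∂volume.restrict (Set.Ioo 0 T), 0 < y t) ∧
      (∀ z : ℝ → ℝ, IntegrableOn z (Set.Ioo 0 T) →
        (∀ᵐ t ∂volume.restrict (Set.Ioo 0 T),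
          z t + ∫ s in (0:ℝ)..t, (t - s) ^ (γ - 1) * v s * z s = h t) →
        z =ᵐ[volume.restrict (Set.Ioo 0 T)] y) := by
  obtain ⟨hγ0, hγ1⟩ := hγ
  set lam := max C 1
  have hlam : 0 < lam := lt_max_of_lt_right one_pos
  set q : ℝ → ℝ := fun t => lam * t ^ (γ - 1) with hq
  set r := resolventKernel γ lam
  have hqc : ContinuousOn q (Ioi 0) := continuousOn_const.mul (continuousOn_rpow_Ioi _)
  have hq0 : ∀ t, 0 < t → 0 ≤ q t := fun t ht => by positivity
  have hrc : ContinuousOn r (Ioi 0) := continuousOn_resolventKernel hγ0 lam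
  have hr0 : ∀ t, 0 < t → 0 ≤ r t := fun t ht => (resolventKernel_pos hγ0 hγ1.le hlam ht).le
  obtain ⟨σ, hσ, hLσ⟩ := exists_lintegral_expWeight_mul_rpow_le hγ0 hlam
  set L := causalExtension q
  set R := causalExtension r
  have hL : Measurable L := measurable_causalExtension hqc
  have hR : Measurable R := measurable_causalExtension hrc
  have hres : R + L ⋆ₗ R = L := causalExtension_resolventKernel_add hγ0 hγ1.le hlam
  have hLfin (F : ℝ → ℝ≥0∞) (hF : Measurable F) (hFσ : ∫⁻ t, expWeight σ t * F t ≠ ∞) :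
      ∀ᵐ t, (L ⋆ₗ F) t ≠ ∞ := by
    refine ae_ne_top_of_lintegral_expWeight_mul (measurable_lconvolution _ hL hF) (σ := σ) ?_
    rw [lintegral_expWeight_mul_lconvolution σ hF hL]
    exact ENNReal.mul_ne_top (ne_top_of_le_ne_top (by simp) hLσ) hFσ
  have hmod (f : ℝ → ℝ) (hf : IntegrableOn f (Ioo 0 T)) : ∃ F : ℝ → ℝ≥0∞, Measurable F ∧
      (∀ t ≤ 0, F t = 0) ∧ (∀ t ∉ Ioo 0 T, F t = 0) ∧
      (∀ᵐ t ∂volume.restrict (Ioo 0 T), ‖f t‖ₑ = F t) ∧ ∫⁻ t, expWeight σ t * F t ≠ ∞ := by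
    have hae : ∀ᵐ t ∂volume.restrict (Ioo 0 T),
        ‖f t‖ₑ = (Ioo 0 T).indicator (fun t => ‖hf.1.mk f t‖ₑ) t := by
      filter_upwards [hf.1.ae_eq_mk, ae_restrict_mem measurableSet_Ioo] with t ht htT
      rw [indicator_of_mem htT, ← ht]
    have hsupp : ∀ t ∉ Ioo 0 T, (Ioo 0 T).indicator (fun t => ‖hf.1.mk f t‖ₑ) t = 0 :=
      fun t ht => indicator_of_notMem ht _
    refine ⟨_, (hf.1.stronglyMeasurable_mk.measurable.enorm).indicator measurableSet_Ioo,
      fun t ht => hsupp t fun h => absurd h.1 (not_lt.2 ht), hsupp, hae,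
      lintegral_expWeight_mul_ne_top hσ.le hsupp ?_⟩
    rw [← lintegral_congr_ae hae]
    exact hf.2.ne
  obtain ⟨H, hH, hH0, -, hhH, hHσ⟩ := hmod h hh_int
  have hRH : ∀ᵐ t ∂volume.restrict (Ioo 0 T), (R ⋆ₗ H) t < H t := by
    filter_upwards [hh_res lam hlam, hh_pos, hhH, ae_restrict_mem measurableSet_Ioo,
      ae_restrict_of_ae (hLfin H hH hHσ)] with t ht hpos hHt htT hfin
    rw [intervalIntegral.integral_of_le htT.1.le, integral_Ioc_eq_integral_Ioo,
      integral_eq_toReal_lconvolution hrc hr0 hh_int.1 hH0 (hh_pos.mono fun _ => le_of_lt) hhH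
        htT.2] at ht
    have hRfin : (R ⋆ₗ H) t ≠ ∞ := by
      refine ne_top_of_le_ne_top hfin (lintegral_mono fun s => mul_le_mul_left ?_ _)
      rw [← hres]
      exact le_self_add
    rw [← hHt, Real.enorm_of_nonneg hpos.le, ENNReal.lt_ofReal_iff_toReal_lt hRfin]
    linarith
  set a : ℝ → ℝ≥0∞ := fun s => min (ENNReal.ofReal (1 - v s / lam)) 2
  have ha : Measurable a := by fun_prop
  have hv_le : ∀ᵐ t ∂volume.restrict (Ioo 0 T), |v t| ≤ lam :=
    hv_bdd.mono fun t ht => ht.trans (le_max_left _ _)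
  have hav : ∀ᵐ t ∂volume.restrict (Ioo 0 T), lam * (1 - (a t).toReal) = v t := by
    filter_upwards [hv_le] with t ht
    have h1 := abs_le.1 ht
    have h2 : v t / lam ≤ 1 := (div_le_one hlam).2 h1.2
    have h3 : -1 ≤ v t / lam := by rw [le_div_iff₀ hlam]; linarith
    have h4 : a t = ENNReal.ofReal (1 - v t / lam) := by
      refine min_eq_left ?_
      rw [show (2 : ℝ≥0∞) = ENNReal.ofReal 2 by simp]
      exact ENNReal.ofReal_le_ofReal (by linarith)
    rw [h4, ENNReal.toReal_ofReal (by linarith)]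
    field_simp
    ring
  obtain ⟨Y, hY, hY0, hYσ, hYpos, hYeq⟩ := exists_causal_solution hL hR hH ha
    (causalExtension_of_nonpos q) (causalExtension_of_nonpos r) hH0 hres
    (fun t => min_le_right _ _) hLσ hHσ hRH
  have hYfin := ae_ne_top_of_lintegral_expWeight_mul hY hYσ
  have haY : Measurable (a * Y) := ha.mul hY
  have haY0 : ∀ t ≤ 0, (a * Y) t = 0 := fun t ht => by simp [hY0 t ht]
  have hafin : ∀ t, a t ≠ ∞ := fun t => ne_top_of_le_ne_top (by simp) (min_le_right _ _)
  have haYσ : ∫⁻ t, expWeight σ t * (a * Y) t ≠ ∞ := by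
    refine ne_top_of_le_ne_top (ENNReal.mul_ne_top (a := 2) (by simp) hYσ) ?_
    rw [← lintegral_const_mul _ ((measurable_expWeight σ).fun_mul hY)]
    refine lintegral_mono fun t => ?_
    rw [Pi.mul_apply, mul_left_comm]
    exact mul_le_mul_left (min_le_right _ _) _
  have hyint : IntegrableOn (fun t => (Y t).toReal) (Ioo 0 T) :=
    integrable_toReal_of_lintegral_ne_top hY.aemeasurable
      (setLIntegral_Ioo_ne_top_of_lintegral_expWeight_mul hσ.le T hYσ)
  have hyeq : ∀ᵐ t ∂volume.restrict (Ioo 0 T),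
      (Y t).toReal + ∫ s in (0:ℝ)..t, (t - s) ^ (γ - 1) * v s * (Y s).toReal = h t := by
    have hyY : ∀ᵐ t ∂volume.restrict (Ioo 0 T), ‖(Y t).toReal‖ₑ = Y t := by
      filter_upwards [ae_restrict_of_ae hYfin] with t ht
      rw [Real.enorm_of_nonneg ENNReal.toReal_nonneg, ENNReal.ofReal_toReal ht]
    have hayY : ∀ᵐ t ∂volume.restrict (Ioo 0 T), ‖((a * Y) t).toReal‖ₑ = (a * Y) t := by
      filter_upwards [ae_restrict_of_ae hYfin] with t ht
      rw [Real.enorm_of_nonneg ENNReal.toReal_nonneg, Pi.mul_apply,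
        ENNReal.ofReal_toReal (ENNReal.mul_ne_top (hafin t) ht)]
    have hym := hyint.1
    have haym : AEStronglyMeasurable (fun t => ((a * Y) t).toReal) (volume.restrict (Ioo 0 T)) :=
      haY.ennreal_toReal.aestronglyMeasurable
    filter_upwards [hYeq, hhH, hh_pos, ae_restrict_mem measurableSet_Ioo,
      ae_restrict_of_ae hYfin, ae_restrict_of_ae (hLfin Y hY hYσ),
      ae_restrict_of_ae (hLfin (a * Y) haY haYσ)] with t heq hHt hpos htT hYt hLY hLaY
    have hsplit : ∫ s in (0:ℝ)..t, (t - s) ^ (γ - 1) * v s * (Y s).toReal =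
        ((L ⋆ₗ Y) t).toReal - ((L ⋆ₗ (a * Y)) t).toReal := by
      rw [← integral_eq_toReal_lconvolution hqc hq0 hym hY0
          (ae_of_all _ fun _ => ENNReal.toReal_nonneg) hyY htT.2,
        ← integral_eq_toReal_lconvolution hqc hq0 haym haY0
          (ae_of_all _ fun _ => ENNReal.toReal_nonneg) hayY htT.2,
        ← integral_sub
          (integrableOn_of_lconvolution_ne_top hqc hq0 hym hY0 hyY htT.2 hLY)
          (integrableOn_of_lconvolution_ne_top hqc hq0 haym haY0 hayY htT.2 hLaY),
        intervalIntegral.integral_of_le htT.1.le, integral_Ioc_eq_integral_Ioo]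
      refine integral_congr_ae ?_
      filter_upwards [ae_restrict_of_ae_restrict_of_subset (Ioo_subset_Ioo_right htT.2.le) hav]
        with s hs
      rw [← hs, hq, Pi.mul_apply, ENNReal.toReal_mul]
      ring
    have hreal := congrArg ENNReal.toReal heq
    rw [ENNReal.toReal_add hYt hLY, ENNReal.toReal_add (by rw [← hHt]; simp) hLaY, ← hHt,
      Real.enorm_of_nonneg hpos.le, ENNReal.toReal_ofReal hpos.le] at hreal
    rw [hsplit]
    linarith
  refine ⟨fun t => (Y t).toReal, hyint, hyeq, ?_, fun z hz hzeq => ?_⟩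
  · filter_upwards [hYpos, ae_restrict_of_ae hYfin] with t ht htop
    exact ENNReal.toReal_pos ht.ne' htop
  have hvint (f : ℝ → ℝ) (hf : IntegrableOn f (Ioo 0 T)) :
      ∀ᵐ t ∂volume.restrict (Ioo 0 T),
        IntegrableOn (fun s => (t - s) ^ (γ - 1) * v s * f s) (Ioo 0 t) := by
    obtain ⟨F, hF, hF0, -, hfF, hFσ⟩ := hmod f hf
    filter_upwards [ae_restrict_of_ae (hLfin F hF hFσ), ae_restrict_mem measurableSet_Ioo]
      with t hfin htT
    have hI := integrableOn_of_lconvolution_ne_top hqc hq0 hf.1 hF0 hfF htT.2 hfin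
    have hbdd := hI.bdd_mul (c := 1) (f := fun s => v s / lam)
      (hv_meas.div_const lam).aestronglyMeasurable (by
        filter_upwards [ae_restrict_of_ae_restrict_of_subset (Ioo_subset_Ioo_right htT.2.le) hv_le]
          with s hs
        rw [norm_div, Real.norm_eq_abs, Real.norm_of_nonneg hlam.le]
        exact (div_le_one hlam).2 hs)
    refine hbdd.congr (ae_of_all _ fun s => ?_)
    simp only [hq]
    field_simp
  set d : ℝ → ℝ := fun t => z t - (Y t).toReal with hd
  have hdint : IntegrableOn d (Ioo 0 T) := hz.sub hyint
  obtain ⟨D, hD, hD0, hDsupp, hdD, hDσ⟩ := hmod d hdint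
  have hDle : ∀ᵐ t ∂volume.restrict (Ioo 0 T), D t ≤ (L ⋆ₗ D) t := by
    filter_upwards [hyeq, hzeq, hvint z hz, hvint _ hyint, hdD,
      ae_restrict_mem measurableSet_Ioo] with t hyt hzt hzI hyI hDt htT
    rw [intervalIntegral.integral_of_le htT.1.le, integral_Ioc_eq_integral_Ioo] at hyt hzt
    have hdt : d t = -∫ s in Ioo 0 t, (t - s) ^ (γ - 1) * v s * d s := by
      have h1 : ∫ s in Ioo 0 t, (t - s) ^ (γ - 1) * v s * d s =
          (∫ s in Ioo 0 t, (t - s) ^ (γ - 1) * v s * z s) -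
            ∫ s in Ioo 0 t, (t - s) ^ (γ - 1) * v s * (Y s).toReal := by
        rw [← integral_sub hzI hyI]
        simp only [hd, mul_sub]
      rw [h1, hd]
      linarith
    rw [← hDt, ← lintegral_enorm_eq_lconvolution hq0 hD0 hdD htT.2, hdt, enorm_neg]
    refine (enorm_integral_le_lintegral_enorm _).trans (lintegral_mono_ae ?_)
    filter_upwards [ae_restrict_of_ae_restrict_of_subset (Ioo_subset_Ioo_right htT.2.le) hv_le]
      with s hs
    rw [hq, enorm_mul, enorm_mul, enorm_mul, enorm_mul, mul_comm ‖lam‖ₑ]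
    gcongr
    rw [enorm_le_iff_norm_le, Real.norm_eq_abs, Real.norm_of_nonneg hlam.le]
    exact hs
  have hD_zero := ae_eq_zero_of_le_lconvolution hL hD hLσ hDσ (by
    rw [ae_restrict_iff' measurableSet_Ioo] at hDle
    filter_upwards [hDle] with t ht
    by_cases htT : t ∈ Ioo 0 T
    · exact ht htT
    · simp [hDsupp t htT])
  filter_upwards [hdD, ae_restrict_of_ae hD_zero] with t ht ht0
  rw [ht0, enorm_eq_zero] at ht
  exact sub_eq_zero.1 ht
end

section
/- Let γ ∈ (0,1) and T > 0. Let f : [0,∞) × ℝ → ℝ be measurable and locally bounded, and assume that for every M > 0 there is L > 0 such that |f(t,x) − f(t,y)| ≤ L|x − y| for a.e. t ∈ [0,T] and all x, y ∈ [−M,M]. Let u₁, u₂ be continuous on [0,T] with uᵢ(t) = uᵢ(0) + (1/Γ(γ)) ∫₀ᵗ (t−s)^(γ−1) f(s, uᵢ(s)) ds for all t ∈ [0,T], i = 1,2. If u₁(0) < u₂(0), then u₁(t) < u₂(t) for every t ∈ [0,T]. -/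
open MeasureTheory Set Filter

theorem integrableOn_rpow_neg_mul_one_sub_rpow {γ : ℝ} (hγ : γ ∈ Ioo (0 : ℝ) 1) :
    IntegrableOn (fun z : ℝ => z ^ (-γ) * (1 - z) ^ (γ - 1)) (Ioo 0 1) := by
  have h := Complex.betaIntegral_convergent (u := ((1 - γ : ℝ) : ℂ)) (v := (γ : ℂ))
    (by simpa using hγ.2) (by simpa using hγ.1)
  rw [intervalIntegrable_iff_integrableOn_Ioo_of_le zero_le_one] at h
  refine IntegrableOn.congr_fun h.re ?_ measurableSet_Ioo
  intro z hz
  have h1 : (z : ℂ) ^ (((1 - γ : ℝ) : ℂ) - 1) = ((z ^ (-γ) : ℝ) : ℂ) := by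
    rw [Complex.ofReal_cpow hz.1.le]; congr 1; push_cast; ring
  have h2 : (1 - (z : ℂ)) ^ ((γ : ℂ) - 1) = (((1 - z) ^ (γ - 1) : ℝ) : ℂ) := by
    rw [Complex.ofReal_cpow (by linarith [hz.2])]; push_cast; rfl
  simp only [h1, h2, ← Complex.ofReal_mul]
  exact Complex.ofReal_re _

/-- The density `(r - ε)^(-γ) / r` on `(ε, ∞)` (the sweeping of the Dirac mass at `0` out of
`(0, ε)`) reproduces the kernel `τ^(γ-1)` for `τ > ε`. -/
theorem integral_sweeping_kernel {γ ε τ : ℝ} (hγ : γ ∈ Ioo (0 : ℝ) 1) (hε : 0 < ε) (hτ : ε < τ) :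
    IntegrableOn (fun r => (r - ε) ^ (-γ) * r⁻¹ * (τ - r) ^ (γ - 1)) (Ioo ε τ) ∧
    ∫ r in Ioo ε τ, (r - ε) ^ (-γ) * r⁻¹ * (τ - r) ^ (γ - 1) =
      ε ^ (-γ) * τ ^ (γ - 1) * ∫ z in Ioo (0 : ℝ) 1, z ^ (-γ) * (1 - z) ^ (γ - 1) := by
  have hτ0 : 0 < τ := hε.trans hτ
  have hd : 0 < τ - ε := sub_pos.2 hτ
  set φ : ℝ → ℝ := fun z => ε * τ / (τ - (τ - ε) * z) with hφ
  have hD : ∀ z ∈ Ioo (0 : ℝ) 1, 0 < τ - (τ - ε) * z := fun z hz => by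
    nlinarith [mul_pos hd (sub_pos.2 hz.2)]
  have hsub1 : ∀ z ∈ Ioo (0 : ℝ) 1,
      φ z - ε = ε * (τ - ε) * z / (τ - (τ - ε) * z) := fun z hz => by
    have := (hD z hz).ne'
    simp only [hφ]; field_simp; ring
  have hsub2 : ∀ z ∈ Ioo (0 : ℝ) 1,
      τ - φ z = τ * (τ - ε) * (1 - z) / (τ - (τ - ε) * z) := fun z hz => by
    have := (hD z hz).ne'
    simp only [hφ]; field_simp; ring
  have himg : φ '' Ioo 0 1 = Ioo ε τ := by
    ext r
    constructor
    · rintro ⟨z, hz, rfl⟩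
      have h1 := hsub1 z hz
      have h2 := hsub2 z hz
      have hz1 := sub_pos.2 hz.2
      have hz0 := hz.1
      have hDz := hD z hz
      have p1 : 0 < φ z - ε := by rw [h1]; positivity
      have p2 : 0 < τ - φ z := by rw [h2]; positivity
      exact ⟨by linarith, by linarith⟩
    · rintro ⟨h1, h2⟩
      have hr : 0 < r := hε.trans h1
      refine ⟨τ * (r - ε) / (r * (τ - ε)), ⟨?_, ?_⟩, ?_⟩
      · have := sub_pos.2 h1; positivity
      · rw [div_lt_one (by positivity)]; nlinarith
      · simp only [hφ]
        have : τ - (τ - ε) * (τ * (r - ε) / (r * (τ - ε))) = ε * τ / r := by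
          field_simp; ring
        rw [this]; field_simp
  have hinj : InjOn φ (Ioo 0 1) := by
    intro x hx y hy hxy
    simp only [hφ] at hxy
    rw [div_eq_div_iff (hD x hx).ne' (hD y hy).ne'] at hxy
    have := mul_left_cancel₀ (by positivity) hxy
    have h3 : (τ - ε) * x = (τ - ε) * y := by linarith
    exact mul_left_cancel₀ hd.ne' h3
  have hder : ∀ z ∈ Ioo (0 : ℝ) 1, HasDerivWithinAt φ
      (ε * τ * (τ - ε) / (τ - (τ - ε) * z) ^ 2) (Ioo 0 1) z := fun z hz => by
    have h1 : HasDerivAt (fun z => τ - (τ - ε) * z) (-(τ - ε)) z := by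
      simpa using ((hasDerivAt_id z).const_mul (τ - ε)).const_sub τ
    have h2 := (hasDerivAt_const z (ε * τ)).div h1 (hD z hz).ne'
    refine (h2.congr_deriv ?_).hasDerivWithinAt
    simp; ring
  have hcomp : EqOn (fun z => |ε * τ * (τ - ε) / (τ - (τ - ε) * z) ^ 2| •
      ((φ z - ε) ^ (-γ) * (φ z)⁻¹ * (τ - φ z) ^ (γ - 1)))
      (fun z => ε ^ (-γ) * τ ^ (γ - 1) * (z ^ (-γ) * (1 - z) ^ (γ - 1))) (Ioo 0 1) := by
    intro z hz
    have hz1 : 0 < 1 - z := sub_pos.2 hz.2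
    have hz0 := hz.1
    have hDz := hD z hz
    dsimp only
    rw [hsub1 z hz, hsub2 z hz, abs_of_pos (by positivity), smul_eq_mul]
    simp only [hφ]
    set D := τ - (τ - ε) * z
    rw [Real.div_rpow (by positivity) hDz.le, Real.div_rpow (by positivity) hDz.le,
      Real.mul_rpow (by positivity) hz0.le, Real.mul_rpow hε.le hd.le,
      Real.mul_rpow (by positivity) hz1.le, Real.mul_rpow hτ0.le hd.le,
      Real.rpow_sub_one hDz.ne' γ, Real.rpow_sub_one hd.ne' γ,
      Real.rpow_neg hDz.le, Real.rpow_neg hd.le]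
    have a1 : D ^ γ ≠ 0 := by positivity
    have a2 : (τ - ε) ^ γ ≠ 0 := by positivity
    field_simp
  constructor
  · rw [← himg, integrableOn_image_iff_integrableOn_abs_deriv_smul measurableSet_Ioo hder hinj]
    exact IntegrableOn.congr_fun ((integrableOn_rpow_neg_mul_one_sub_rpow hγ).const_mul _)
      hcomp.symm measurableSet_Ioo
  · rw [← himg, integral_image_eq_integral_abs_deriv_smul measurableSet_Ioo hder hinj,
      setIntegral_congr_fun measurableSet_Ioo hcomp, integral_const_mul]

/-- The sweeping density has mass at most that of the kernel identity, with a gap independent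
of `ε`. -/
theorem integral_sweeping_density_le {γ ε t : ℝ} (hγ : γ ∈ Ioo (0 : ℝ) 1) (hε : 0 < ε)
    (ht : ε < t) :
    IntegrableOn (fun r => (r - ε) ^ (-γ) * r⁻¹) (Ioo ε t) ∧
    ∫ r in Ioo ε t, (r - ε) ^ (-γ) * r⁻¹ ≤
      ε ^ (-γ) * (∫ z in Ioo (0 : ℝ) 1, z ^ (-γ) * (1 - z) ^ (γ - 1)) -
        t * ((2 * t) ^ (-γ) * (2 * t)⁻¹) := by
  have ht0 : 0 < t := hε.trans ht
  obtain ⟨hint, heq⟩ := integral_sweeping_kernel hγ hε (by linarith : ε < 2 * t)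
  have hle : ∀ r ∈ Ioo ε (2 * t), (r - ε) ^ (-γ) * r⁻¹ ≤
      (2 * t) ^ (1 - γ) * ((r - ε) ^ (-γ) * r⁻¹ * (2 * t - r) ^ (γ - 1)) := fun r hr => by
    have hr0 : 0 < r := hε.trans hr.1
    have h1 : 0 < r - ε := sub_pos.2 hr.1
    have h2 : 0 < 2 * t - r := sub_pos.2 hr.2
    have h3 : (2 * t) ^ (γ - 1) ≤ (2 * t - r) ^ (γ - 1) :=
      Real.rpow_le_rpow_of_nonpos h2 (by linarith) (by linarith [hγ.2])
    have h4 : (2 * t) ^ (1 - γ) * (2 * t) ^ (γ - 1) = 1 := by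
      rw [← Real.rpow_add (by positivity)]; simp
    calc (r - ε) ^ (-γ) * r⁻¹
        = (2 * t) ^ (1 - γ) * ((r - ε) ^ (-γ) * r⁻¹ * (2 * t) ^ (γ - 1)) := by
          linear_combination -((r - ε) ^ (-γ) * r⁻¹) * h4
      _ ≤ _ := by gcongr
  have hP : IntegrableOn (fun r => (r - ε) ^ (-γ) * r⁻¹) (Ioo ε (2 * t)) := by
    refine Integrable.mono' (hint.const_mul ((2 * t) ^ (1 - γ)))
      (by fun_prop) ?_
    filter_upwards [ae_restrict_mem measurableSet_Ioo] with r hr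
    have hr0 : 0 < r := hε.trans hr.1
    have h1 : 0 < r - ε := sub_pos.2 hr.1
    rw [Real.norm_of_nonneg (by positivity)]
    exact hle r hr
  have hP1 := hP.mono_set (Ioo_subset_Ioo_right (by linarith : t ≤ 2 * t))
  have hP2 := hP.mono_set (Ico_subset_Ioo_left ht : Ico t (2 * t) ⊆ Ioo ε (2 * t))
  refine ⟨hP1, ?_⟩
  have hsplit : ∫ r in Ioo ε (2 * t), (r - ε) ^ (-γ) * r⁻¹ =
      (∫ r in Ioo ε t, (r - ε) ^ (-γ) * r⁻¹) + ∫ r in Ico t (2 * t), (r - ε) ^ (-γ) * r⁻¹ := by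
    rw [← setIntegral_union _ measurableSet_Ico hP1 hP2,
      Ioo_union_Ico_eq_Ioo ht (by linarith)]
    exact disjoint_left.2 fun x hx hy => (hx.2.trans_le hy.1).false
  have htotal : ∫ r in Ioo ε (2 * t), (r - ε) ^ (-γ) * r⁻¹ ≤
      ε ^ (-γ) * ∫ z in Ioo (0 : ℝ) 1, z ^ (-γ) * (1 - z) ^ (γ - 1) := by
    have h := setIntegral_mono_on hP (hint.const_mul ((2 * t) ^ (1 - γ))) measurableSet_Ioo hle
    rw [integral_const_mul, heq] at h
    have h4 : (2 * t) ^ (1 - γ) * (2 * t) ^ (γ - 1) = 1 := by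
      rw [← Real.rpow_add (by positivity)]; simp
    refine h.trans_eq ?_
    linear_combination
      (ε ^ (-γ) * ∫ z in Ioo (0 : ℝ) 1, z ^ (-γ) * (1 - z) ^ (γ - 1)) * h4
  have htail : t * ((2 * t) ^ (-γ) * (2 * t)⁻¹) ≤
      ∫ r in Ico t (2 * t), (r - ε) ^ (-γ) * r⁻¹ := by
    have h := setIntegral_mono_on (μ := volume) (s := Ico t (2 * t))
      (f := fun _ => (2 * t) ^ (-γ) * (2 * t)⁻¹)
      (integrableOn_const measure_Ico_lt_top.ne) hP2 measurableSet_Ico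
      (fun r hr => by
        have h1 : 0 < r - ε := sub_pos.2 (ht.trans_le hr.1)
        have hr0 : 0 < r := ht0.trans_le hr.1
        have h3 : (2 * t) ^ (-γ) ≤ (r - ε) ^ (-γ) :=
          Real.rpow_le_rpow_of_nonpos h1 (by linarith [hr.2]) (by linarith [hγ.1])
        have h5 : (2 * t)⁻¹ ≤ r⁻¹ := inv_anti₀ hr0 hr.2.le
        exact mul_le_mul h3 h5 (by positivity) (by positivity))
    refine le_trans (le_of_eq ?_) h
    rw [setIntegral_const, smul_eq_mul, Measure.real, Real.volume_Ico,
      ENNReal.toReal_ofReal (by linarith)]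
    ring
  linarith

/-- Fubini's theorem combined with `integral_sweeping_kernel`. -/
theorem integral_sweeping_fractionalIntegral {γ ε t M : ℝ} (hγ : γ ∈ Ioo (0 : ℝ) 1) (hε : 0 < ε)
    (ht : ε < t) {G : ℝ → ℝ} (hG : Measurable G) (hM : ∀ τ, |G τ| ≤ M) :
    IntegrableOn (fun r => (r - ε) ^ (-γ) * r⁻¹ * ∫ τ in Ioo r t, (τ - r) ^ (γ - 1) * G τ)
      (Ioo ε t) ∧
    ∫ r in Ioo ε t, (r - ε) ^ (-γ) * r⁻¹ * ∫ τ in Ioo r t, (τ - r) ^ (γ - 1) * G τ =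
      ε ^ (-γ) * (∫ z in Ioo (0 : ℝ) 1, z ^ (-γ) * (1 - z) ^ (γ - 1)) *
        ∫ τ in Ioo ε t, τ ^ (γ - 1) * G τ := by
  set B := ∫ z in Ioo (0 : ℝ) 1, z ^ (-γ) * (1 - z) ^ (γ - 1)
  set P : ℝ → ℝ := (Ioo ε t).indicator fun r => (r - ε) ^ (-γ) * r⁻¹ with hPdef
  set A : ℝ → ℝ := (Ioo 0 t).indicator fun x => x ^ (γ - 1) with hAdef
  set H : ℝ → ℝ := (Ioo 0 t).indicator G with hHdef
  have hP : Integrable P :=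
    (integrable_indicator_iff measurableSet_Ioo).2 (integral_sweeping_density_le hγ hε ht).1
  have hA : Integrable A := by
    refine (integrable_indicator_iff measurableSet_Ioo).2 ?_
    rw [← intervalIntegrable_iff_integrableOn_Ioo_of_le (hε.trans ht).le]
    exact intervalIntegral.intervalIntegrable_rpow' (by linarith [hγ.1])
  have hHm : Measurable H := hG.indicator measurableSet_Ioo
  have hHM : ∀ τ, ‖H τ‖ ≤ M := fun τ => (norm_indicator_le_norm_self _ _).trans (hM τ)
  have hF : Integrable (fun p : ℝ × ℝ => H p.1 * (P p.2 * A (p.1 - p.2)))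
      (volume.prod volume) :=
    (hP.convolution_integrand (ContinuousLinearMap.mul ℝ ℝ) hA).bdd_mul
      (hHm.comp measurable_fst).aestronglyMeasurable (ae_of_all _ fun p => hHM p.1)
  have hinner1 : ∀ r, ∫ τ, H τ * (P r * A (τ - r)) =
      (Ioo ε t).indicator
        (fun r => (r - ε) ^ (-γ) * r⁻¹ * ∫ τ in Ioo r t, (τ - r) ^ (γ - 1) * G τ) r := by
    intro r
    by_cases hr : r ∈ Ioo ε t
    · rw [indicator_of_mem hr, ← integral_indicator measurableSet_Ioo, ← integral_const_mul]
      congr 1 with τ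
      have hr0 : 0 < r := hε.trans hr.1
      simp only [hPdef, hAdef, hHdef, indicator_of_mem hr]
      by_cases hτ : τ ∈ Ioo r t
      · rw [indicator_of_mem (show τ ∈ Ioo 0 t from ⟨hr0.trans hτ.1, hτ.2⟩), indicator_of_mem hτ,
          indicator_of_mem (show τ - r ∈ Ioo 0 t from ⟨by linarith [hτ.1], by linarith [hτ.2]⟩)]
        ring
      · rw [indicator_of_notMem hτ]
        by_cases h : τ < t
        · rw [indicator_of_notMem (s := Ioo 0 t) (a := τ - r)]
          · simp
          · exact fun h' => hτ ⟨by linarith [h'.1], h⟩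
        · rw [indicator_of_notMem (s := Ioo 0 t) (a := τ)]
          · simp
          · exact fun h' => h h'.2
    · simp [hPdef, indicator_of_notMem hr]
  have hinner2 : ∀ τ, ∫ r, H τ * (P r * A (τ - r)) =
      (Ioo ε t).indicator (fun τ => ε ^ (-γ) * B * (τ ^ (γ - 1) * G τ)) τ := by
    intro τ
    rw [integral_const_mul]
    by_cases hτ0 : τ ∈ Ioo 0 t
    swap
    · rw [indicator_of_notMem fun h => hτ0 ⟨hε.trans h.1, h.2⟩, hHdef, indicator_of_notMem hτ0,
        zero_mul]
    have hPA : (fun r => P r * A (τ - r)) =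
        (Ioo ε τ).indicator fun r => (r - ε) ^ (-γ) * r⁻¹ * (τ - r) ^ (γ - 1) := by
      ext r
      simp only [hPdef, hAdef]
      by_cases hr : r ∈ Ioo ε τ
      · rw [indicator_of_mem hr, indicator_of_mem (show r ∈ Ioo ε t from ⟨hr.1, hr.2.trans hτ0.2⟩),
          indicator_of_mem (show τ - r ∈ Ioo 0 t from ⟨by linarith [hr.2], by linarith [hr.1, hτ0.2]⟩)]
      · rw [indicator_of_notMem hr]
        by_cases h : ε < r
        · rw [indicator_of_notMem (s := Ioo 0 t) (a := τ - r), mul_zero]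
          exact fun h' => hr ⟨h, by linarith [h'.1]⟩
        · rw [indicator_of_notMem (s := Ioo ε t) (a := r), zero_mul]
          exact fun h' => h h'.1
    rw [hPA, integral_indicator measurableSet_Ioo]
    by_cases hτ : ε < τ
    · rw [(integral_sweeping_kernel hγ hε hτ).2, indicator_of_mem (show τ ∈ Ioo ε t from ⟨hτ, hτ0.2⟩),
        hHdef, indicator_of_mem hτ0]
      ring
    · rw [Ioo_eq_empty hτ, indicator_of_notMem fun h => hτ h.1]
      simp
  constructor
  · rw [← integrable_indicator_iff measurableSet_Ioo]
    refine hF.integral_prod_right.congr (ae_of_all _ fun r => ?_)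
    exact hinner1 r
  · rw [← integral_indicator measurableSet_Ioo, ← integral_const_mul,
      ← integral_indicator measurableSet_Ioo]
    have h := integral_integral_swap (f := fun τ r => H τ * (P r * A (τ - r))) hF
    simp only [hinner1, hinner2] at h
    exact h.symm

/-- A fractional integral of a bounded source, started at a positive value, cannot first reach zero
at a point where the source tends to zero. Time is reversed: `v r` is the value at distance `r`
before the touching time. -/
theorem fractionalIntegral_not_touch_zero {γ t M c w₀ : ℝ} (hγ : γ ∈ Ioo (0 : ℝ) 1) (ht : 0 < t)
    (hc : 0 < c) (hw₀ : 0 < w₀) {G v : ℝ → ℝ} (hG : Measurable G) (hM : ∀ τ, |G τ| ≤ M)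
    (hv : ∀ r ∈ Ico 0 t, v r = w₀ + c * ∫ τ in Ioo r t, (τ - r) ^ (γ - 1) * G τ)
    (hv0 : v 0 = 0) (hvnn : ∀ r ∈ Ico 0 t, 0 ≤ v r)
    (hG0 : ∀ η > 0, ∃ δ > 0, ∀ᵐ τ, τ ∈ Ioo 0 δ → |G τ| ≤ η) : False := by
  set B := ∫ z in Ioo (0 : ℝ) 1, z ^ (-γ) * (1 - z) ^ (γ - 1) with hB
  set κ := t * ((2 * t) ^ (-γ) * (2 * t)⁻¹) with hκ
  have hκ0 : 0 < κ := by positivity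
  have hBnn : 0 ≤ B := setIntegral_nonneg measurableSet_Ioo fun z hz =>
    mul_nonneg (Real.rpow_nonneg hz.1.le _) (Real.rpow_nonneg (by linarith [hz.2]) _)
  have hγ0 := hγ.1
  obtain ⟨η, hη, hηlt⟩ : ∃ η > 0, c * B / γ * η < w₀ * κ := by
    refine ⟨w₀ * κ / (c * B / γ + 1), by positivity, ?_⟩
    rw [mul_div_assoc', div_lt_iff₀ (by positivity)]
    nlinarith [mul_pos hw₀ hκ0]
  obtain ⟨δ, hδ, hGδ⟩ := hG0 η hη
  obtain ⟨ε, hε, hεδ, hεt⟩ : ∃ ε > 0, ε < δ ∧ ε < t := by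
    obtain ⟨ε, h1, h2⟩ := exists_between (lt_min hδ ht)
    exact ⟨ε, h1, lt_min_iff.1 h2⟩
  obtain ⟨hPint, hPle⟩ := integral_sweeping_density_le hγ hε hεt
  obtain ⟨hSint, hS⟩ := integral_sweeping_fractionalIntegral hγ hε hεt hG hM
  rw [← hB] at hPle hS
  rw [← hκ] at hPle
  set S := ∫ r in Ioo ε t, (r - ε) ^ (-γ) * r⁻¹ * ∫ τ in Ioo r t, (τ - r) ^ (γ - 1) * G τ
  set m := ∫ r in Ioo ε t, (r - ε) ^ (-γ) * r⁻¹
  have hlow : -w₀ * m ≤ c * S := by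
    rw [← integral_const_mul, ← integral_const_mul]
    refine setIntegral_mono_on (hPint.const_mul _) (hSint.const_mul _) measurableSet_Ioo ?_
    intro r hr
    have hr0 : 0 < r := hε.trans hr.1
    have h1 : 0 < r - ε := sub_pos.2 hr.1
    have h2 := hvnn r ⟨hr0.le, hr.2⟩
    rw [hv r ⟨hr0.le, hr.2⟩] at h2
    have h3 : 0 ≤ (r - ε) ^ (-γ) * r⁻¹ := by positivity
    nlinarith [mul_nonneg h3 h2]
  have hA : IntegrableOn (fun τ : ℝ => τ ^ (γ - 1)) (Ioo 0 t) := by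
    rw [← intervalIntegrable_iff_integrableOn_Ioo_of_le ht.le]
    exact intervalIntegral.intervalIntegrable_rpow' (by linarith)
  have hAG : IntegrableOn (fun τ => τ ^ (γ - 1) * G τ) (Ioo 0 t) :=
    hA.mul_bdd hG.aestronglyMeasurable (ae_of_all _ hM)
  have hA1 := hA.mono_set (Ioo_subset_Ioo_right hεt.le : Ioo 0 ε ⊆ Ioo 0 t)
  have hAG1 := hAG.mono_set (Ioo_subset_Ioo_right hεt.le : Ioo 0 ε ⊆ Ioo 0 t)
  have hsplit : ∫ τ in Ioo 0 t, τ ^ (γ - 1) * G τ =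
      (∫ τ in Ioo 0 ε, τ ^ (γ - 1) * G τ) + ∫ τ in Ioo ε t, τ ^ (γ - 1) * G τ := by
    rw [← integral_Ico_eq_integral_Ioo (x := ε), ← setIntegral_union _ measurableSet_Ico hAG1
      (hAG.mono_set (Ico_subset_Ioo_left hε)), Ioo_union_Ico_eq_Ioo hε hεt.le]
    exact disjoint_left.2 fun x hx hy => (hx.2.trans_le hy.1).false
  have hpow : ∫ τ in Ioo 0 ε, τ ^ (γ - 1) = ε ^ γ / γ := by
    rw [← integral_Ioc_eq_integral_Ioo, ← intervalIntegral.integral_of_le hε.le,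
      integral_rpow (Or.inl (by linarith))]
    simp [Real.zero_rpow hγ0.ne']
  have hsmall : -(η * (ε ^ γ / γ)) ≤ ∫ τ in Ioo 0 ε, τ ^ (γ - 1) * G τ := by
    rw [← hpow, ← neg_mul, ← integral_const_mul]
    refine integral_mono_ae (hA1.const_mul _) hAG1 ?_
    filter_upwards [ae_restrict_of_ae hGδ, ae_restrict_mem measurableSet_Ioo] with τ h1 hτ
    have h2 := (abs_le.1 (h1 ⟨hτ.1, hτ.2.trans hεδ⟩)).1
    have h3 : 0 ≤ τ ^ (γ - 1) := Real.rpow_nonneg hτ.1.le _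
    nlinarith [mul_le_mul_of_nonneg_left h2 h3]
  have htouch : w₀ + c * ∫ τ in Ioo 0 t, τ ^ (γ - 1) * G τ = 0 := by
    have h := hv 0 ⟨le_rfl, ht⟩
    simp only [sub_zero, hv0] at h
    exact h.symm
  have hεB : 0 ≤ ε ^ (-γ) * B := by positivity
  have hεε : ε ^ (-γ) * ε ^ γ = 1 := by rw [← Real.rpow_add hε]; simp
  have hup : c * S ≤ ε ^ (-γ) * B * (-w₀ + c * (η * (ε ^ γ / γ))) := by
    rw [hS]
    calc _ = ε ^ (-γ) * B * (c * ∫ τ in Ioo ε t, τ ^ (γ - 1) * G τ) := by ring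
      _ ≤ _ := mul_le_mul_of_nonneg_left ?_ hεB
    rw [hsplit] at htouch
    nlinarith [mul_le_mul_of_nonneg_left hsmall hc.le]
  have hfin : ε ^ (-γ) * B * (-w₀ + c * (η * (ε ^ γ / γ))) =
      -w₀ * (ε ^ (-γ) * B) + c * B / γ * η := by
    linear_combination (B * c * η / γ) * hεε
  nlinarith [mul_le_mul_of_nonneg_left hPle hw₀.le]

theorem intervalIntegrable_fractional_kernel_mul {γ t C : ℝ} (hγ : 0 < γ) (ht : 0 ≤ t)
    {φ : ℝ → ℝ} (hφ : Measurable φ) (hC : ∀ s ∈ Icc 0 t, |φ s| ≤ C) :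
    IntervalIntegrable (fun s => (t - s) ^ (γ - 1) * φ s) volume 0 t := by
  have h : IntervalIntegrable (fun s : ℝ => (t - s) ^ (γ - 1)) volume 0 t := by
    have h := (intervalIntegral.intervalIntegrable_rpow' (a := 0) (b := t)
      (by linarith : -1 < γ - 1)).comp_sub_left t
    simpa using h.symm
  rw [intervalIntegrable_iff_integrableOn_Icc_of_le ht] at h ⊢
  refine Integrable.mul_bdd (c := C) h hφ.aestronglyMeasurable ?_
  filter_upwards [ae_restrict_mem measurableSet_Icc] with s hs using hC s hs

theorem ContinuousOn.exists_continuous_eqOn_Icc {a b : ℝ} (hab : a ≤ b) {u : ℝ → ℝ}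
    (hu : ContinuousOn u (Icc a b)) : ∃ v : ℝ → ℝ, Continuous v ∧ EqOn v u (Icc a b) :=
  ⟨IccExtend hab ((Icc a b).domRestrict u), hu.domRestrict.Icc_extend',
    fun s hs => by rw [IccExtend_of_mem _ _ hs]; rfl⟩

/-- A continuous function that is positive at `0` but not on all of `[0,T]` has a first zero. -/
theorem ContinuousOn.exists_first_zero {T : ℝ} {w : ℝ → ℝ} (hw : ContinuousOn w (Icc 0 T))
    (h0 : 0 < w 0) (h : ∃ t ∈ Icc 0 T, w t ≤ 0) :
    ∃ t ∈ Ioc 0 T, w t = 0 ∧ ∀ s ∈ Ico 0 t, 0 < w s := by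
  have hclosed : IsClosed (Icc 0 T ∩ w ⁻¹' Iic 0) :=
    hw.preimage_isClosed_of_isClosed isClosed_Icc isClosed_Iic
  obtain ⟨t, ⟨⟨ht0, htT⟩, hwt⟩, hleast⟩ :=
    (isCompact_Icc.of_isClosed_subset hclosed inter_subset_left).exists_isLeast h
  have hpos : ∀ s ∈ Ico 0 t, 0 < w s := fun s hs => by
    by_contra! hs'
    exact (hleast ⟨⟨hs.1, hs.2.le.trans htT⟩, hs'⟩).not_gt hs.2
  have htne : t ≠ 0 := by rintro rfl; exact (lt_of_lt_of_le h0 hwt).false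
  refine ⟨t, ⟨ht0.lt_of_ne' htne, htT⟩, ?_, hpos⟩
  obtain ⟨s, hs, hs0⟩ :=
    intermediate_value_Icc' ht0 (hw.mono (Icc_subset_Icc_right htT)) ⟨hwt, h0.le⟩
  rcases hs.2.eq_or_lt with rfl | hlt
  · exact hs0
  · exact absurd hs0 (hpos s ⟨hs.1, hlt⟩).ne'

/-- Strict monotonicity of solutions in the initial value:
two solutions of the fractional ODE with `u₁(0) < u₂(0)` satisfy `u₁ < u₂` on `[0,T]`. -/
theorem fractional_ode_strict_monotonicity_in_initial_value
    (γ T : ℝ) (hγ : γ ∈ Set.Ioo (0:ℝ) 1) (hT : 0 < T)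
    (f : ℝ → ℝ → ℝ)
    (hf_meas : Measurable (Function.uncurry f))
    (hf_bdd : ∀ T' > (0:ℝ), ∀ M > (0:ℝ), ∃ C : ℝ,
      ∀ t ∈ Set.Icc 0 T', ∀ x ∈ Set.Icc (-M) M, |f t x| ≤ C)
    (hf_lip : ∀ M > (0:ℝ), ∃ L > (0:ℝ),
      ∀ᵐ t ∂volume.restrict (Set.Icc (0:ℝ) T),
        ∀ x ∈ Set.Icc (-M) M, ∀ y ∈ Set.Icc (-M) M, |f t x - f t y| ≤ L * |x - y|)
    (u₁ u₂ : ℝ → ℝ)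
    (hc1 : ContinuousOn u₁ (Set.Icc 0 T)) (hc2 : ContinuousOn u₂ (Set.Icc 0 T))
    (he1 : ∀ t ∈ Set.Icc 0 T,
      u₁ t = u₁ 0 + (1 / Real.Gamma γ) * ∫ s in (0:ℝ)..t, (t - s) ^ (γ - 1) * f s (u₁ s))
    (he2 : ∀ t ∈ Set.Icc 0 T,
      u₂ t = u₂ 0 + (1 / Real.Gamma γ) * ∫ s in (0:ℝ)..t, (t - s) ^ (γ - 1) * f s (u₂ s))
    (h0 : u₁ 0 < u₂ 0) :
    ∀ t ∈ Set.Icc 0 T, u₁ t < u₂ t := by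
  obtain ⟨hγ0, hγ1⟩ := hγ
  obtain ⟨v₁, hv₁, hvu₁⟩ := hc1.exists_continuous_eqOn_Icc hT.le
  obtain ⟨v₂, hv₂, hvu₂⟩ := hc2.exists_continuous_eqOn_Icc hT.le
  obtain ⟨M₁, hM₁⟩ := isCompact_Icc.exists_bound_of_continuousOn hc1
  obtain ⟨M₂, hM₂⟩ := isCompact_Icc.exists_bound_of_continuousOn hc2
  set M := max (max M₁ M₂) 1
  have hM0 : 0 < M := lt_max_of_lt_right one_pos
  have hu₁M : ∀ s ∈ Icc 0 T, u₁ s ∈ Icc (-M) M := fun s hs =>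
    abs_le.1 ((hM₁ s hs).trans ((le_max_left _ _).trans (le_max_left _ _)))
  have hu₂M : ∀ s ∈ Icc 0 T, u₂ s ∈ Icc (-M) M := fun s hs =>
    abs_le.1 ((hM₂ s hs).trans ((le_max_right _ _).trans (le_max_left _ _)))
  obtain ⟨C, hC⟩ := hf_bdd T hT M hM0
  obtain ⟨L, hL, hLip⟩ := hf_lip M hM0
  rw [ae_restrict_iff' measurableSet_Icc] at hLip
  have hC0 : 0 ≤ C :=
    (abs_nonneg _).trans (hC 0 (left_mem_Icc.2 hT.le) _ (hu₁M 0 (left_mem_Icc.2 hT.le)))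
  have hφ₁ : Measurable fun s => f s (v₁ s) := hf_meas.comp (measurable_id.prodMk hv₁.measurable)
  have hφ₂ : Measurable fun s => f s (v₂ s) := hf_meas.comp (measurable_id.prodMk hv₂.measurable)
  have hφ₁C : ∀ s ∈ Icc 0 T, |f s (v₁ s)| ≤ C := fun s hs => by
    rw [hvu₁ hs]; exact hC s hs _ (hu₁M s hs)
  have hφ₂C : ∀ s ∈ Icc 0 T, |f s (v₂ s)| ≤ C := fun s hs => by
    rw [hvu₂ hs]; exact hC s hs _ (hu₂M s hs)
  set g : ℝ → ℝ := (Icc 0 T).indicator fun s => f s (v₂ s) - f s (v₁ s) with hg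
  have hg_meas : Measurable g := (hφ₂.sub hφ₁).indicator measurableSet_Icc
  have hgC : ∀ s, |g s| ≤ C + C := fun s => by
    by_cases hs : s ∈ Icc 0 T
    · rw [hg, indicator_of_mem hs]
      exact (abs_sub _ _).trans (add_le_add (hφ₂C s hs) (hφ₁C s hs))
    · rw [hg, indicator_of_notMem hs, abs_zero]
      positivity
  set w : ℝ → ℝ := fun s => u₂ s - u₁ s with hw
  have hwc : ContinuousOn w (Icc 0 T) := hc2.sub hc1
  have hw0 : 0 < w 0 := sub_pos.2 h0
  have hgw : ∀ᵐ s, s ∈ Icc 0 T → |g s| ≤ L * |w s| := by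
    filter_upwards [hLip] with s hs hsT
    rw [hg, indicator_of_mem hsT, hvu₁ hsT, hvu₂ hsT]
    exact hs hsT _ (hu₂M s hsT) _ (hu₁M s hsT)
  have heq : ∀ t ∈ Icc 0 T,
      w t = w 0 + 1 / Real.Gamma γ * ∫ s in (0 : ℝ)..t, (t - s) ^ (γ - 1) * g s := by
    intro t ht
    have hsub : Icc 0 t ⊆ Icc 0 T := Icc_subset_Icc_right ht.2
    have hi₁ := intervalIntegrable_fractional_kernel_mul hγ0 ht.1 hφ₁
      fun s hs => hφ₁C s (hsub hs)
    have hi₂ := intervalIntegrable_fractional_kernel_mul hγ0 ht.1 hφ₂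
      fun s hs => hφ₂C s (hsub hs)
    have e₁ : ∫ s in (0 : ℝ)..t, (t - s) ^ (γ - 1) * f s (u₁ s) =
        ∫ s in (0 : ℝ)..t, (t - s) ^ (γ - 1) * f s (v₁ s) :=
      intervalIntegral.integral_congr fun s hs => by
        rw [uIcc_of_le ht.1] at hs
        simp only [hvu₁ (hsub hs)]
    have e₂ : ∫ s in (0 : ℝ)..t, (t - s) ^ (γ - 1) * f s (u₂ s) =
        ∫ s in (0 : ℝ)..t, (t - s) ^ (γ - 1) * f s (v₂ s) :=
      intervalIntegral.integral_congr fun s hs => by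
        rw [uIcc_of_le ht.1] at hs
        simp only [hvu₂ (hsub hs)]
    have e : ∫ s in (0 : ℝ)..t, (t - s) ^ (γ - 1) * g s =
        (∫ s in (0 : ℝ)..t, (t - s) ^ (γ - 1) * f s (v₂ s)) -
          ∫ s in (0 : ℝ)..t, (t - s) ^ (γ - 1) * f s (v₁ s) := by
      rw [← intervalIntegral.integral_sub hi₂ hi₁]
      refine intervalIntegral.integral_congr fun s hs => ?_
      rw [uIcc_of_le ht.1] at hs
      simp only [hg, indicator_of_mem (hsub hs)]
      ring
    have h₁ := he1 t ht
    have h₂ := he2 t ht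
    rw [e₁] at h₁
    rw [e₂] at h₂
    rw [e]
    simp only [hw]
    linear_combination h₂ - h₁
  by_contra! hcon
  obtain ⟨s, hs, hs'⟩ := hcon
  obtain ⟨t, ⟨ht0, htT⟩, hwt, hpos⟩ :=
    hwc.exists_first_zero hw0 ⟨s, hs, sub_nonpos.2 hs'⟩
  refine fractionalIntegral_not_touch_zero (M := C + C) (G := fun τ => g (t - τ))
    (v := fun r => w (t - r)) ⟨hγ0, hγ1⟩ ht0 (one_div_pos.2 (Real.Gamma_pos_of_pos hγ0)) hw0
    (hg_meas.comp (measurable_const.sub measurable_id)) (fun τ => hgC _) ?_ (by simpa using hwt)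
    ?_ ?_
  · intro r hr
    rw [heq (t - r) ⟨by linarith [hr.2], by linarith [hr.1]⟩, ← integral_Ioc_eq_integral_Ioo,
      ← intervalIntegral.integral_of_le hr.2.le]
    congr 2
    have h := intervalIntegral.integral_comp_sub_left (a := r) (b := t)
      (fun s => (t - r - s) ^ (γ - 1) * g s) t
    rw [sub_self] at h
    rw [← h]
    congr 1 with τ
    rw [show t - r - (t - τ) = τ - r by ring]
  · intro r hr
    rcases hr.1.eq_or_lt with rfl | hr0
    · simp [hwt]
    · exact (hpos (t - r) ⟨by linarith [hr.2], by linarith⟩).le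
  · intro η hη
    have hcont := Metric.continuousWithinAt_iff.1 (hwc t ⟨ht0.le, htT⟩) (η / L) (by positivity)
    obtain ⟨δ, hδ, hwδ⟩ := hcont
    refine ⟨min δ t, lt_min hδ ht0, ?_⟩
    filter_upwards [(Measure.measurePreserving_sub_left volume t).quasiMeasurePreserving.ae hgw]
      with τ h hτ
    have hτδ := hτ.2.trans_le (min_le_left _ _)
    have hτt := hτ.2.trans_le (min_le_right _ _)
    have hmem : t - τ ∈ Icc 0 T := ⟨by linarith, by linarith [hτ.1]⟩
    have hd := hwδ hmem (by rw [Real.dist_eq, abs_lt]; constructor <;> linarith [hτ.1])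
    rw [hwt, Real.dist_eq, sub_zero, lt_div_iff₀ hL] at hd
    exact (h hmem).trans (by linarith)
end
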